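/- Let P ⊆ ℝ² be a simple polygon region with vertices v₁, …, vₙ such that [vₙ, v₁] is an edge of P, P is contained in one of the two closed half-planes bounded by the line through vₙ and v₁, and P is weakly visible from the edge [vₙ, v₁], i.e., every point of P is seen in P from some point of [vₙ, v₁]. Let G ⊆ {v₁, …, vₙ} be a set of vertices that guards the frontier of P. Then there exists a set G' ⊆ {v₁, …, vₙ} of vertices with |G'| ≤ |G| such that G ∪ G' guards all of P, i.e., every point of P is seen in P from some point of G ∪ G'. -/

import Mathlib

/-- `P` is a simple polygon region with the `n` vertices `v 0, …, v (n-1)`: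
a compact subset of the plane with nonempty interior, equal to the closure of its
interior, whose frontier is the union of the `n` edges `[v i, v (i+1)]` (indices
mod `n`), such that consecutive edges meet exactly in their common vertex and
non-consecutive edges are disjoint. -/
def IsSimplePolygonRegion {n : ℕ} [NeZero n]
    (P : Set (EuclideanSpace ℝ (Fin 2))) (v : Fin n → EuclideanSpace ℝ (Fin 2)) : Prop :=
  3 ≤ n ∧ Function.Injective v ∧ IsCompact P ∧ (interior P).Nonempty ∧
  P = closure (interior P) ∧
  frontier P = ⋃ i : Fin n, segment ℝ (v i) (v (i + 1)) ∧
  (∀ i : Fin n, segment ℝ (v i) (v (i + 1)) ∩ segment ℝ (v (i + 1)) (v (i + 1 + 1))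
      = {v (i + 1)}) ∧
  (∀ i j : Fin n, i ≠ j → j ≠ i + 1 → i ≠ j + 1 →
    Disjoint (segment ℝ (v i) (v (i + 1))) (segment ℝ (v j) (v (j + 1))))

section Aux
open Set Filter Topology Metric

structure SPR {n : ℕ} [NeZero n] (P : Set (ℝ × ℝ)) (v : Fin n → ℝ × ℝ) : Prop where
  n3 : 3 ≤ n
  inj : Function.Injective v
  cpt : IsCompact P
  int_ne : (interior P).Nonempty
  reg : P = closure (interior P)
  fr : frontier P = ⋃ i : Fin n, segment ℝ (v i) (v (i + 1))
  cons : ∀ i : Fin n, segment ℝ (v i) (v (i + 1)) ∩ segment ℝ (v (i + 1)) (v (i + 1 + 1))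
      = {v (i + 1)}
  disj : ∀ i j : Fin n, i ≠ j → j ≠ i + 1 → i ≠ j + 1 →
    Disjoint (segment ℝ (v i) (v (i + 1))) (segment ℝ (v j) (v (j + 1)))

namespace SPR
variable {n : ℕ} [NeZero n] {P : Set (ℝ × ℝ)} {v : Fin n → ℝ × ℝ}

lemma add_one_ne (h : SPR P v) (i : Fin n) : i + 1 ≠ i := by
  intro hh
  have h3 := h.n3
  have h1 : (1 : Fin n) = 0 := by simpa using hh
  have := congrArg Fin.val h1
  rw [Fin.val_one', Fin.val_zero, Nat.mod_eq_of_lt (by omega)] at this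
  omega

lemma add_two_ne (h : SPR P v) (i : Fin n) : i + 1 + 1 ≠ i := by
  intro hh
  have h3 := h.n3
  have h1 : (1 : Fin n) + 1 = 0 := by
    rw [add_assoc] at hh
    simpa using hh
  have := congrArg Fin.val h1
  rw [Fin.val_add, Fin.val_one', Fin.val_zero, Nat.mod_eq_of_lt (show 1 < n by omega),
    Nat.mod_eq_of_lt (by omega)] at this
  omega

/-- a point lying on two different edges is a vertex -/
lemma two_edges (h : SPR P v) {i j : Fin n} (hij : i ≠ j) {x : ℝ × ℝ}
    (hi : x ∈ segment ℝ (v i) (v (i + 1))) (hj : x ∈ segment ℝ (v j) (v (j + 1))) :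
    (j = i + 1 ∧ x = v (i + 1)) ∨ (i = j + 1 ∧ x = v (j + 1)) := by
  by_cases h1 : j = i + 1
  · left
    refine ⟨h1, ?_⟩
    have : x ∈ segment ℝ (v i) (v (i + 1)) ∩ segment ℝ (v (i + 1)) (v (i + 1 + 1)) :=
      ⟨hi, by rw [← h1]; exact hj⟩
    rw [h.cons] at this
    exact this
  by_cases h2 : i = j + 1
  · right
    refine ⟨h2, ?_⟩
    have : x ∈ segment ℝ (v j) (v (j + 1)) ∩ segment ℝ (v (j + 1)) (v (j + 1 + 1)) :=
      ⟨hj, by rw [← h2]; exact hi⟩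
    rw [h.cons] at this
    exact this
  · exact absurd hj (Set.disjoint_left.1 (h.disj i j hij h1 h2) hi)

lemma vertex_edges (h : SPR P v) {i j : Fin n}
    (hj : v (i + 1) ∈ segment ℝ (v j) (v (j + 1))) : j = i ∨ j = i + 1 := by
  by_cases hij : i = j
  · exact Or.inl hij.symm
  · rcases h.two_edges hij (right_mem_segment ℝ _ _) hj with h1 | h1
    · exact Or.inr h1.1
    · left
      have := h.inj h1.2
      simpa using this.symm

lemma closed (h : SPR P v) : IsClosed P := h.cpt.isClosed

lemma fr_sub (h : SPR P v) : frontier P ⊆ P := h.closed.frontier_subset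

lemma edge_fr (h : SPR P v) (i : Fin n) : segment ℝ (v i) (v (i + 1)) ⊆ frontier P := by
  rw [h.fr]; exact subset_iUnion (fun i : Fin n => segment ℝ (v i) (v (i + 1))) i

lemma seg_compact (a b : ℝ × ℝ) : IsCompact (segment ℝ a b) := by
  rw [segment_eq_image]
  exact isCompact_Icc.image (by fun_prop)

lemma fr_preconn (h : SPR P v) : IsPreconnected (frontier P) := by
  have e : frontier P = ⋃ k : ℕ, segment ℝ (v (Fin.ofNat n k)) (v (Fin.ofNat n k + 1)) := by
    rw [h.fr]
    ext x
    simp only [mem_iUnion]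
    constructor
    · rintro ⟨i, hi⟩
      exact ⟨i.val, by simpa using hi⟩
    · rintro ⟨k, hk⟩
      exact ⟨_, hk⟩
  rw [e]
  apply IsPreconnected.iUnion_of_chain
  · intro k
    exact (convex_segment _ _).isPreconnected
  · intro k
    refine ⟨v (Fin.ofNat n k + 1), right_mem_segment ℝ _ _, ?_⟩
    have : Fin.ofNat n (Order.succ k) = Fin.ofNat n k + 1 := by
      change Fin.ofNat n (k + 1) = _
      apply Fin.ext
      simp [Fin.val_add, Fin.val_one']
    rw [this]
    exact left_mem_segment ℝ _ _

/-- isolating finitely many edges -/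
lemma isolate (h : SPR P v) (x : ℝ × ℝ) :
    ∃ r > 0, ∀ q ∈ ball x r, ∀ j, q ∈ segment ℝ (v j) (v (j + 1)) →
      x ∈ segment ℝ (v j) (v (j + 1)) := by
  have hev : ∀ᶠ q in 𝓝 x, ∀ j, q ∈ segment ℝ (v j) (v (j + 1)) →
      x ∈ segment ℝ (v j) (v (j + 1)) := by
    rw [eventually_all]
    intro j
    by_cases hx : x ∈ segment ℝ (v j) (v (j + 1))
    · exact Eventually.of_forall fun _ _ => hx
    · filter_upwards [(seg_compact (v j) (v (j+1))).isClosed.isOpen_compl.mem_nhds hx] with q hq hq'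
      exact absurd hq' hq
  obtain ⟨r, hr, hr'⟩ := Metric.eventually_nhds_iff_ball.1 hev
  exact ⟨r, hr, hr'⟩

end SPR

lemma ray_seg {x a q : ℝ × ℝ} (hq : q ∈ ball x ‖a - x‖) :
    q ∈ segment ℝ x a ↔ ∃ s : ℝ, 0 ≤ s ∧ q = x + s • (a - x) := by
  rw [segment_eq_image']
  constructor
  · rintro ⟨s, hs, rfl⟩
    exact ⟨s, hs.1, rfl⟩
  · rintro ⟨s, hs, rfl⟩
    refine ⟨s, ⟨hs, ?_⟩, rfl⟩
    rw [mem_ball, dist_eq_norm] at hq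
    simp only [add_sub_cancel_left, norm_smul, Real.norm_eq_abs, abs_of_nonneg hs] at hq
    by_contra hc
    push Not at hc
    nlinarith [norm_nonneg (a - x)]

lemma SPR.local_rays {n : ℕ} [NeZero n] {P : Set (ℝ × ℝ)} {v : Fin n → ℝ × ℝ} (h : SPR P v)
    {x : ℝ × ℝ} (hx : x ∈ frontier P) :
    ∃ r > 0, ∃ d1 d2 : ℝ × ℝ, d1 ≠ 0 ∧ d2 ≠ 0 ∧ (∀ s : ℝ, 0 < s → d2 ≠ s • d1) ∧
     (∀ q ∈ ball x r, q ∈ frontier P ↔ ((∃ s : ℝ, 0 ≤ s ∧ q = x + s • d1) ∨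
        (∃ s : ℝ, 0 ≤ s ∧ q = x + s • d2))) ∧
     (∀ i, x ∈ segment ℝ (v i) (v (i+1)) → x ∉ range v → d1 = v i - x ∧ d2 = v (i+1) - x) := by
  obtain ⟨r0, hr0, hiso⟩ := h.isolate x
  by_cases hv : x ∈ range v
  · obtain ⟨k, rfl⟩ := hv
    obtain ⟨i, rfl⟩ : ∃ i, k = i + 1 := ⟨k - 1, by simp⟩
    have hd1 : v i - v (i+1) ≠ 0 := by
      rw [sub_ne_zero]; intro e; exact h.add_one_ne i (h.inj e).symm
    have hd2 : v (i+1+1) - v (i+1) ≠ 0 := by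
      rw [sub_ne_zero]; intro e; exact h.add_one_ne (i+1) (h.inj e)
    refine ⟨min r0 (min ‖v i - v (i+1)‖ ‖v (i+1+1) - v (i+1)‖), ?_, _, _, hd1, hd2, ?_, ?_, ?_⟩
    · exact lt_min hr0 (lt_min (norm_pos_iff.2 hd1) (norm_pos_iff.2 hd2))
    · intro s hs e
      -- the two edges overlap
      have key : ∀ t : ℝ, 0 ≤ t → t ≤ 1 → t * s ≤ 1 →
          v (i+1) + t • (v (i+1+1) - v (i+1)) ∈
            segment ℝ (v i) (v (i + 1)) ∩ segment ℝ (v (i + 1)) (v (i + 1 + 1)) := by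
        intro t ht ht1 hts
        constructor
        · rw [segment_symm, segment_eq_image']
          exact ⟨t * s, ⟨by positivity, hts⟩, by simp only [e, smul_smul]⟩
        · rw [segment_eq_image']
          exact ⟨t, ⟨ht, ht1⟩, rfl⟩
      have := key (min 1 s⁻¹) (by positivity) (min_le_left _ _) (by
        calc min 1 s⁻¹ * s ≤ s⁻¹ * s := by gcongr; exact min_le_right _ _
          _ = 1 := inv_mul_cancel₀ hs.ne')
      rw [h.cons, mem_singleton_iff, add_eq_left, smul_eq_zero] at this
      rcases this with h0 | h0
      · have : 0 < min 1 s⁻¹ := by positivity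
        linarith
      · exact hd2 h0
    · intro q hq
      simp only [mem_ball, lt_min_iff] at hq
      rw [← ray_seg (mem_ball.2 hq.2.1), ← ray_seg (mem_ball.2 hq.2.2)]
      constructor
      · intro hqf
        rw [h.fr, mem_iUnion] at hqf
        obtain ⟨j, hj⟩ := hqf
        have := hiso q (mem_ball.2 hq.1) j hj
        rcases h.vertex_edges this with rfl | rfl
        · left; rwa [segment_symm]
        · right; exact hj
      · rintro (h1 | h1)
        · rw [segment_symm] at h1; exact h.edge_fr _ h1
        · exact h.edge_fr _ h1
    · intro j hj hnv
      exact absurd (mem_range_self _) hnv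
  · have hx' := hx
    rw [h.fr, mem_iUnion] at hx'
    obtain ⟨i, hi⟩ := hx'
    have hd1 : v i - x ≠ 0 := by
      rw [sub_ne_zero]; intro e; exact hv ⟨_, e⟩
    have hd2 : v (i+1) - x ≠ 0 := by
      rw [sub_ne_zero]; intro e; exact hv ⟨_, e⟩
    have huniq : ∀ j, x ∈ segment ℝ (v j) (v (j+1)) → j = i := by
      intro j hj
      by_contra hne
      rcases h.two_edges hne hj hi with h1 | h1
      · exact hv ⟨_, h1.2.symm⟩
      · exact hv ⟨_, h1.2.symm⟩
    refine ⟨min r0 (min ‖v i - x‖ ‖v (i+1) - x‖), ?_, _, _, hd1, hd2, ?_, ?_, ?_⟩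
    · exact lt_min hr0 (lt_min (norm_pos_iff.2 hd1) (norm_pos_iff.2 hd2))
    · intro s hs e
      obtain ⟨a, b, ha, hb, hab, hxe⟩ := hi
      have h0 : a • (v i - x) + b • (v (i+1) - x) = 0 := by
        rw [smul_sub, smul_sub]
        have : a • x + b • x = x := by rw [← add_smul, hab, one_smul]
        calc _ = (a • v i + b • v (i+1)) - (a • x + b • x) := by abel
          _ = 0 := by rw [hxe, this, sub_self]
      rw [e, smul_smul, ← add_smul, smul_eq_zero] at h0
      rcases h0 with h0 | h0
      · have : 0 < a + b * s := by
          rcases ha.eq_or_lt with h1 | h1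
          · have : b = 1 := by linarith
            subst this; linarith
          · positivity
        linarith
      · exact hd1 h0
    · intro q hq
      simp only [mem_ball, lt_min_iff] at hq
      rw [← ray_seg (mem_ball.2 hq.2.1), ← ray_seg (mem_ball.2 hq.2.2)]
      constructor
      · intro hqf
        rw [h.fr, mem_iUnion] at hqf
        obtain ⟨j, hj⟩ := hqf
        have := huniq j (hiso q (mem_ball.2 hq.1) j hj)
        subst this
        -- split the segment at x
        have hw := mem_segment_iff_wbtw.1 hi
        have hwq := mem_segment_iff_wbtw.1 hj
        simp only [mem_segment_iff_wbtw]
        rw [segment_eq_image] at hi hj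
        obtain ⟨t, ht, rfl⟩ := hi
        obtain ⟨u, hu, rfl⟩ := hj
        have hl : ∀ w : ℝ, (1 - w) • v j + w • v (j+1) = AffineMap.lineMap (v j) (v (j+1)) w := by
          intro w; rw [AffineMap.lineMap_apply_module]
        simp only [hl] at *
        have e0 : v j = AffineMap.lineMap (v j) (v (j+1)) (0:ℝ) := by simp
        have e1 : v (j+1) = AffineMap.lineMap (v j) (v (j+1)) (1:ℝ) := by simp
        rcases le_total u t with hut | hut
        · left
          have : Wbtw ℝ t u 0 := by
            rw [wbtw_comm]; exact Wbtw.of_le_of_le hu.1 hut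
          have := this.map (AffineMap.lineMap (v j) (v (j+1)))
          simpa using this
        · right
          have : Wbtw ℝ t u 1 := Wbtw.of_le_of_le hut hu.2
          have := this.map (AffineMap.lineMap (v j) (v (j+1)))
          simpa using this
      · intro hh
        apply h.edge_fr i
        rcases hh with h1 | h1
        · exact (convex_segment _ _).segment_subset hi (left_mem_segment ℝ _ _) h1
        · exact (convex_segment _ _).segment_subset hi (right_mem_segment ℝ _ _) h1
    · intro j hj _
      rw [huniq j hj]; exact ⟨rfl, rfl⟩


lemma preconn_dichotomy {P W : Set (ℝ × ℝ)} (hW : IsPreconnected W)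
    (hd : Disjoint W (frontier P)) : W ⊆ P ∨ Disjoint W P := by
  have h1 : W ⊆ interior P ∪ (closure P)ᶜ := by
    intro w hw
    by_contra hc
    simp only [mem_union, mem_compl_iff, not_or, not_not] at hc
    exact Set.disjoint_left.1 hd hw ⟨hc.2, hc.1⟩
  rcases isPreconnected_iff_subset_of_disjoint.1 hW _ _ isOpen_interior
    isClosed_closure.isOpen_compl h1 (by
      ext z
      simp only [mem_inter_iff, mem_compl_iff, mem_empty_iff_false, iff_false, not_and, not_not]
      intro _ hz
      exact subset_closure (interior_subset hz)) with h2 | h2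
  · exact Or.inl (h2.trans interior_subset)
  · right
    rw [Set.disjoint_left]
    intro w hw hwP
    exact h2 hw (subset_closure hwP)

lemma split_lemma {P W1 W2 C : Set (ℝ × ℝ)} {x : ℝ × ℝ} (hcl : IsClosed P)
    (hreg : P = closure (interior P)) (hx : x ∈ frontier P) (hC : IsOpen C) (hxC : x ∈ C)
    (h1 : IsPreconnected W1) (h2 : IsPreconnected W2) (hW : C \ frontier P = W1 ∪ W2) :
    (W1 ⊆ P ∧ Disjoint W2 P) ∨ (W2 ⊆ P ∧ Disjoint W1 P) := by
  have d1 : Disjoint W1 (frontier P) := by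
    rw [Set.disjoint_left]; intro w hw
    have : w ∈ C \ frontier P := by rw [hW]; exact Or.inl hw
    exact this.2
  have d2 : Disjoint W2 (frontier P) := by
    rw [Set.disjoint_left]; intro w hw
    have : w ∈ C \ frontier P := by rw [hW]; exact Or.inr hw
    exact this.2
  rcases preconn_dichotomy h1 d1 with a1 | a1 <;> rcases preconn_dichotomy h2 d2 with a2 | a2
  · exfalso
    have : C ⊆ P := by
      intro q hq
      by_cases hqf : q ∈ frontier P
      · exact hcl.frontier_subset hqf
      · have : q ∈ W1 ∪ W2 := by rw [← hW]; exact ⟨hq, hqf⟩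
        exact this.elim (fun h => a1 h) (fun h => a2 h)
    exact hx.2 (interior_maximal this hC hxC)
  · exact Or.inl ⟨a1, a2⟩
  · exact Or.inr ⟨a2, a1⟩
  · exfalso
    have hxc : x ∈ closure (interior P) := by rw [← hreg]; exact hcl.frontier_subset hx
    obtain ⟨q, hqC, hqi⟩ := mem_closure_iff.1 hxc C hC hxC
    have hqf : q ∉ frontier P := fun hf => hf.2 hqi
    have : q ∈ W1 ∪ W2 := by rw [← hW]; exact ⟨hqC, hqf⟩
    rcases this with h | h
    · exact Set.disjoint_left.1 a1 h (interior_subset hqi)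
    · exact Set.disjoint_left.1 a2 h (interior_subset hqi)

/-- orientation determinant -/
def DD (a b q : ℝ × ℝ) : ℝ := (b.1 - a.1) * (q.2 - a.2) - (b.2 - a.2) * (q.1 - a.1)

lemma DD_cont (a b : ℝ × ℝ) : Continuous (DD a b) := by
  unfold DD; fun_prop

lemma DD_comb {a b p q : ℝ × ℝ} {s t : ℝ} (h : s + t = 1) :
    DD a b (s • p + t • q) = s * DD a b p + t * DD a b q := by
  obtain rfl : s = 1 - t := by linarith
  simp only [DD, Prod.fst_add, Prod.snd_add, Prod.smul_fst, Prod.smul_snd, smul_eq_mul]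
  ring

lemma DD_convex_pos (a b : ℝ × ℝ) : Convex ℝ {q | 0 < DD a b q} := by
  intro p hp q hq s t hs ht hst
  simp only [mem_ofPred_eq] at *
  rw [DD_comb hst]
  rcases hs.eq_or_lt with h | h
  · subst h
    have : t = 1 := by linarith
    subst this; simpa using hq
  · nlinarith [mul_pos h hp, mul_nonneg ht hq.le]

lemma DD_convex_neg (a b : ℝ × ℝ) : Convex ℝ {q | DD a b q < 0} := by
  intro p hp q hq s t hs ht hst
  simp only [mem_ofPred_eq] at *
  rw [DD_comb hst]
  rcases hs.eq_or_lt with h | h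
  · subst h
    have : t = 1 := by linarith
    subst this; simpa using hq
  · nlinarith [mul_pos_of_neg_of_neg (neg_lt_zero.2 h) hp, mul_nonneg ht (neg_nonneg.2 hq.le)]

/-- the local structure in the straight case -/
lemma rays_straight {x d1 d2 q : ℝ × ℝ} (h1 : d1 ≠ 0) (h2 : d2 ≠ 0)
    (hs : ∀ s : ℝ, 0 < s → d2 ≠ s • d1) (hc : d1.1 * d2.2 - d1.2 * d2.1 = 0) :
    ((∃ s : ℝ, 0 ≤ s ∧ q = x + s • d1) ∨ (∃ s : ℝ, 0 ≤ s ∧ q = x + s • d2)) ↔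
      DD x (x + d1) q = 0 := by
  have hn : 0 < d1.1 ^ 2 + d1.2 ^ 2 := by
    by_contra hcon
    push Not at hcon
    apply h1
    ext
    · simp; nlinarith [sq_nonneg d1.1, sq_nonneg d1.2]
    · simp; nlinarith [sq_nonneg d1.1, sq_nonneg d1.2]
  set N := d1.1 ^ 2 + d1.2 ^ 2
  obtain ⟨k, hk⟩ : ∃ k : ℝ, d2 = k • d1 := by
    refine ⟨(d1.1 * d2.1 + d1.2 * d2.2) / N, ?_⟩
    ext
    · simp only [Prod.smul_fst, smul_eq_mul]
      field_simp
      simp only [N]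
      linear_combination (-d1.2) * hc
    · simp only [Prod.smul_snd, smul_eq_mul]
      field_simp
      simp only [N]
      linear_combination (d1.1) * hc
  have hk0 : k < 0 := by
    by_contra hcon
    push Not at hcon
    rcases hcon.eq_or_lt with h | h
    · apply h2; rw [hk, ← h, zero_smul]
    · exact hs k h hk
  constructor
  · rintro (⟨s, _, rfl⟩ | ⟨s, _, rfl⟩)
    · simp [DD]; ring
    · simp [DD, hk]; ring
  · intro h0
    obtain ⟨m, hm⟩ : ∃ m : ℝ, q = x + m • d1 := by
      refine ⟨(d1.1 * (q.1 - x.1) + d1.2 * (q.2 - x.2)) / N, ?_⟩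
      simp only [DD, Prod.fst_add, Prod.snd_add] at h0
      ext
      · simp only [Prod.smul_fst, Prod.fst_add, smul_eq_mul]
        field_simp
        simp only [N]
        linear_combination (-d1.2) * h0
      · simp only [Prod.smul_snd, Prod.snd_add, smul_eq_mul]
        field_simp
        simp only [N]
        linear_combination (d1.1) * h0
    rcases le_total 0 m with h | h
    · exact Or.inl ⟨m, h, hm⟩
    · refine Or.inr ⟨m / k, div_nonneg_of_nonpos h hk0.le, ?_⟩
      rw [hm, hk, smul_smul, div_mul_cancel₀ _ hk0.ne]

lemma rays_bent {x d1 d2 q : ℝ × ℝ} (hc : d1.1 * d2.2 - d1.2 * d2.1 ≠ 0) :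
    ((∃ s : ℝ, 0 ≤ s ∧ q = x + s • d1) ∨ (∃ s : ℝ, 0 ≤ s ∧ q = x + s • d2)) ↔
      (0 ≤ (d1.1 * d2.2 - d1.2 * d2.1) * DD x (x + d1) q ∧
       0 ≤ (d1.1 * d2.2 - d1.2 * d2.1) * DD (x + d2) x q ∧
       (DD x (x + d1) q = 0 ∨ DD (x + d2) x q = 0)) := by
  set c := d1.1 * d2.2 - d1.2 * d2.1
  have hc2 : 0 < c ^ 2 := by positivity
  constructor
  · rintro (⟨s, hs, rfl⟩ | ⟨s, hs, rfl⟩)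
    · have e1 : DD x (x + d1) (x + s • d1) = 0 := by simp [DD]; ring
      have e2 : DD (x + d2) x (x + s • d1) = s * c := by simp [DD, c]; ring
      rw [e1, e2]
      exact ⟨by simp, by nlinarith, Or.inl rfl⟩
    · have e1 : DD x (x + d1) (x + s • d2) = s * c := by simp [DD, c]; ring
      have e2 : DD (x + d2) x (x + s • d2) = 0 := by simp [DD]; ring
      rw [e1, e2]
      exact ⟨by nlinarith, by simp, Or.inr rfl⟩
  · rintro ⟨h1, h2, h3⟩
    have hq : q = x + (DD (x + d2) x q / c) • d1 + (DD x (x + d1) q / c) • d2 := by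
      ext
      · simp only [Prod.smul_fst, Prod.fst_add, smul_eq_mul, DD, Prod.snd_add]
        field_simp
        simp only [c]; ring
      · simp only [Prod.smul_snd, Prod.fst_add, smul_eq_mul, DD, Prod.snd_add]
        field_simp
        simp only [c]; ring
    rcases h3 with h3 | h3
    · left
      refine ⟨DD (x + d2) x q / c, ?_, ?_⟩
      · rw [show DD (x + d2) x q / c = (c * DD (x + d2) x q) / c ^ 2 by field_simp]
        positivity
      · rw [h3, zero_div, zero_smul, add_zero] at hq; exact hq
    · right
      refine ⟨DD x (x + d1) q / c, ?_, ?_⟩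
      · rw [show DD x (x + d1) q / c = (c * DD x (x + d1) q) / c ^ 2 by field_simp]
        positivity
      · rw [h3, zero_div, zero_smul, add_zero] at hq; exact hq

lemma convex_scaled_pos (c : ℝ) (a b : ℝ × ℝ) : Convex ℝ {q | 0 < c * DD a b q} := by
  intro p hp q hq s t hs ht hst
  simp only [mem_ofPred_eq] at *
  rw [DD_comb hst]
  rcases hs.eq_or_lt with h | h
  · subst h
    have : t = 1 := by linarith
    subst this; simpa using hq
  · nlinarith [mul_pos h hp, mul_nonneg ht hq.le]

lemma convex_scaled_neg (c : ℝ) (a b : ℝ × ℝ) : Convex ℝ {q | c * DD a b q < 0} := by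
  have := convex_scaled_pos (-c) a b
  simpa using this

/-- the complement of `P` is locally connected at frontier points -/
lemma SPR.local_conn {n : ℕ} [NeZero n] {P : Set (ℝ × ℝ)} {v : Fin n → ℝ × ℝ} (h : SPR P v)
    {x : ℝ × ℝ} (hx : x ∈ frontier P) : ∃ r > 0, IsPreconnected (ball x r \ P) := by
  obtain ⟨r, hr, d1, d2, h1, h2, hs, hloc, -⟩ := h.local_rays hx
  refine ⟨r, hr, ?_⟩
  have fin : ∀ W1 W2 : Set (ℝ × ℝ), IsPreconnected W1 → IsPreconnected W2 →
      ball x r \ frontier P = W1 ∪ W2 → IsPreconnected (ball x r \ P) := by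
    intro W1 W2 c1 c2 hW
    have gen : ∀ W1 W2 : Set (ℝ × ℝ), ball x r \ frontier P = W1 ∪ W2 → W1 ⊆ P → Disjoint W2 P →
        ball x r \ P = W2 := by
      intro W1 W2 hW a1 a2
      ext q
      constructor
      · rintro ⟨hq, hqP⟩
        have : q ∈ W1 ∪ W2 := by rw [← hW]; exact ⟨hq, fun hf => hqP (h.fr_sub hf)⟩
        exact this.elim (fun h => absurd (a1 h) hqP) id
      · intro hq
        have : q ∈ ball x r \ frontier P := by rw [hW]; exact Or.inr hq
        exact ⟨this.1, Set.disjoint_left.1 a2 hq⟩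
    rcases split_lemma h.closed h.reg hx isOpen_ball (mem_ball_self hr) c1 c2 hW with ⟨a1, a2⟩ | ⟨a1, a2⟩
    · rw [gen W1 W2 hW a1 a2]; exact c2
    · rw [gen W2 W1 (by rw [hW, union_comm]) a1 a2]; exact c1
  by_cases hc : d1.1 * d2.2 - d1.2 * d2.1 = 0
  · apply fin (ball x r ∩ {q | 0 < DD x (x+d1) q}) (ball x r ∩ {q | DD x (x+d1) q < 0})
    · exact ((convex_ball x r).inter (DD_convex_pos _ _)).isPreconnected
    · exact ((convex_ball x r).inter (DD_convex_neg _ _)).isPreconnected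
    · ext q
      simp only [Set.mem_sdiff, mem_union, mem_inter_iff, mem_ofPred_eq]
      constructor
      · rintro ⟨hq, hf⟩
        rw [hloc q hq, rays_straight h1 h2 hs hc] at hf
        rcases lt_or_gt_of_ne hf with h | h
        · exact Or.inr ⟨hq, h⟩
        · exact Or.inl ⟨hq, h⟩
      · rintro (⟨hq, h⟩ | ⟨hq, h⟩)
        · exact ⟨hq, by rw [hloc q hq, rays_straight h1 h2 hs hc]; exact h.ne'⟩
        · exact ⟨hq, by rw [hloc q hq, rays_straight h1 h2 hs hc]; exact h.ne⟩
  · set c := d1.1 * d2.2 - d1.2 * d2.1 with hcdef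
    apply fin (ball x r ∩ {q | 0 < c * DD x (x+d1) q} ∩ {q | 0 < c * DD (x + d2) x q})
      ((ball x r ∩ {q | c * DD x (x+d1) q < 0}) ∪ (ball x r ∩ {q | c * DD (x + d2) x q < 0}))
    · exact (((convex_ball x r).inter (convex_scaled_pos _ _ _)).inter
        (convex_scaled_pos _ _ _)).isPreconnected
    · obtain ⟨ε, hε, hb⟩ : ∃ ε : ℝ, 0 < ε ∧ x - ε • (d1 + d2) ∈ ball x r := by
        have : Tendsto (fun ε : ℝ => x - ε • (d1 + d2)) (𝓝[>] 0) (𝓝 x) := by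
          have : Continuous (fun ε : ℝ => x - ε • (d1 + d2)) := by fun_prop
          have h0 := this.tendsto 0
          simp only [zero_smul, sub_zero] at h0
          exact h0.mono_left nhdsWithin_le_nhds
        have h3 := this.eventually (ball_mem_nhds x hr)
        obtain ⟨ε, h4, h5⟩ := (h3.and self_mem_nhdsWithin).exists
        exact ⟨ε, h5, h4⟩
      have hc2 : 0 < c ^ 2 := by positivity
      apply IsPreconnected.union (x - ε • (d1 + d2))
      · refine ⟨hb, ?_⟩
        have e : DD x (x+d1) (x - ε • (d1 + d2)) = - ε * c := by simp [DD, c]; ring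
        simp only [mem_ofPred_eq, e]; nlinarith
      · refine ⟨hb, ?_⟩
        have e : DD (x + d2) x (x - ε • (d1 + d2)) = - ε * c := by simp [DD, c]; ring
        simp only [mem_ofPred_eq, e]; nlinarith
      · exact ((convex_ball x r).inter (convex_scaled_neg _ _ _)).isPreconnected
      · exact ((convex_ball x r).inter (convex_scaled_neg _ _ _)).isPreconnected
    · ext q
      simp only [Set.mem_sdiff, mem_union, mem_inter_iff, mem_ofPred_eq]
      by_cases hq : q ∈ ball x r
      · simp only [hq, true_and]
        rw [hloc q hq, rays_bent hc]
        have z1 : DD x (x+d1) q = 0 ↔ c * DD x (x+d1) q = 0 := by simp [hc]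
        have z2 : DD (x + d2) x q = 0 ↔ c * DD (x + d2) x q = 0 := by simp [hc]
        rw [z1, z2, ← hcdef]
        generalize c * DD x (x+d1) q = A
        generalize c * DD (x + d2) x q = B
        constructor
        · intro hh
          by_contra hcon
          push Not at hcon
          apply hh
          refine ⟨hcon.2.1, hcon.2.2, ?_⟩
          rcases hcon.2.1.eq_or_lt with h | h
          · exact Or.inl h.symm
          · exact Or.inr (le_antisymm (hcon.1 h) hcon.2.2)
        · rintro (⟨a, b⟩ | a | a) ⟨e1, e2, e3 | e3⟩ <;> linarith
      · simp only [hq, false_and, or_self]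

/-- near a non-vertex frontier point `P` is a half plane -/
lemma SPR.local_half {n : ℕ} [NeZero n] {P : Set (ℝ × ℝ)} {v : Fin n → ℝ × ℝ} (h : SPR P v)
    {x : ℝ × ℝ} {i : Fin n} (hx : x ∈ segment ℝ (v i) (v (i+1))) (hv : x ∉ range v) :
    ∃ r > 0, ∃ s : ℝ, ∀ q ∈ ball x r, q ∈ P ↔ 0 ≤ s * DD (v i) (v (i+1)) q := by
  have hxf := h.edge_fr i hx
  obtain ⟨r, hr, d1, d2, h1, h2, hs, hloc, hd⟩ := h.local_rays hxf
  obtain ⟨e1, e2⟩ := hd i hx hv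
  obtain ⟨a, b, ha, hb, hab, hxe⟩ := hx
  obtain rfl : b = 1 - a := by linarith
  have hb0 : (1 - a) ≠ 0 := by
    intro h0
    apply hv
    refine ⟨i, ?_⟩
    rw [← hxe, h0, show a = 1 by linarith]; simp
  have hb1 : 0 < 1 - a := lt_of_le_of_ne hb (Ne.symm hb0)
  have x1 : x.1 = a * (v i).1 + (1-a) * (v (i+1)).1 := by rw [← hxe]; simp
  have x2 : x.2 = a * (v i).2 + (1-a) * (v (i+1)).2 := by rw [← hxe]; simp
  have hc : d1.1 * d2.2 - d1.2 * d2.1 = 0 := by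
    rw [e1, e2]
    simp only [Prod.fst_sub, Prod.snd_sub, x1, x2]; ring
  have eD : ∀ q, DD x (x+d1) q = -((1-a) * DD (v i) (v (i+1)) q) := by
    intro q
    rw [e1]
    simp only [DD, Prod.fst_add, Prod.snd_add, Prod.fst_sub, Prod.snd_sub, x1, x2]; ring
  have e0 : ∀ q ∈ ball x r, q ∈ frontier P ↔ DD (v i) (v (i+1)) q = 0 := by
    intro q hq
    rw [hloc q hq, rays_straight h1 h2 hs hc, eD]
    simp [hb0]
  set f := DD (v i) (v (i+1)) with hf
  have hW : ball x r \ frontier P = (ball x r ∩ {q | 0 < f q}) ∪ (ball x r ∩ {q | f q < 0}) := by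
    ext q
    simp only [Set.mem_sdiff, mem_union, mem_inter_iff, mem_ofPred_eq]
    by_cases hq : q ∈ ball x r
    · simp only [hq, true_and]
      rw [e0 q hq]
      constructor
      · intro hh
        exact (lt_or_gt_of_ne hh).symm
      · rintro (h | h)
        · exact h.ne'
        · exact h.ne
    · simp only [hq, false_and, or_self]
  refine ⟨r, hr, ?_⟩
  rcases split_lemma h.closed h.reg hxf isOpen_ball (mem_ball_self hr)
    ((convex_ball x r).inter (DD_convex_pos _ _)).isPreconnected
    ((convex_ball x r).inter (DD_convex_neg _ _)).isPreconnected hW with ⟨a1, a2⟩ | ⟨a1, a2⟩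
  · refine ⟨1, fun q hq => ?_⟩
    rw [one_mul]
    constructor
    · intro hqP
      by_contra hcon
      exact Set.disjoint_left.1 a2 ⟨hq, not_le.1 hcon⟩ hqP
    · intro h0
      rcases h0.eq_or_lt with h3 | h3
      · exact h.fr_sub ((e0 q hq).2 h3.symm)
      · exact a1 ⟨hq, h3⟩
  · refine ⟨-1, fun q hq => ?_⟩
    rw [neg_one_mul, neg_nonneg]
    constructor
    · intro hqP
      by_contra hcon
      exact Set.disjoint_left.1 a2 ⟨hq, not_le.1 hcon⟩ hqP
    · intro h0
      rcases h0.eq_or_lt with h3 | h3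
      · exact h.fr_sub ((e0 q hq).2 h3)
      · exact a1 ⟨hq, h3⟩

lemma SPR.compl_preconn {n : ℕ} [NeZero n] {P : Set (ℝ × ℝ)} {v : Fin n → ℝ × ℝ} (h : SPR P v) :
    IsPreconnected Pᶜ := by
  rw [isPreconnected_iff_subset_of_disjoint]
  intro U V hU hV hsub hdis
  have hfc : frontier P ⊆ closure (Pᶜ ∩ U) ∪ closure (Pᶜ ∩ V) := by
    rw [← closure_union, ← inter_union_distrib_left, inter_eq_left.2 hsub]
    rw [frontier_eq_closure_inter_closure]
    exact inter_subset_right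
  have hdisj : ¬ (frontier P ∩ (closure (Pᶜ ∩ U) ∩ closure (Pᶜ ∩ V))).Nonempty := by
    rintro ⟨x, hx, hxU, hxV⟩
    obtain ⟨r, hr, hc⟩ := h.local_conn hx
    obtain ⟨a, ha, ha'⟩ := mem_closure_iff.1 hxU _ isOpen_ball (mem_ball_self hr)
    obtain ⟨b, hb, hb'⟩ := mem_closure_iff.1 hxV _ isOpen_ball (mem_ball_self hr)
    obtain ⟨z, hz, hz'⟩ := hc U V hU hV (fun q hq => hsub hq.2) ⟨a, ⟨ha, ha'.1⟩, ha'.2⟩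
      ⟨b, ⟨hb, hb'.1⟩, hb'.2⟩
    have : z ∈ Pᶜ ∩ (U ∩ V) := ⟨hz.2, hz'⟩
    rw [hdis] at this; exact this
  have gen : ∀ U V : Set (ℝ × ℝ), IsOpen U → IsOpen V → Pᶜ ⊆ U ∪ V → Pᶜ ∩ (U ∩ V) = ∅ →
      (¬ (frontier P ∩ closure (Pᶜ ∩ V)).Nonempty) → Pᶜ ⊆ U := by
    intro U V hU hV hsub hdis hemp
    have hclop : IsClopen (Pᶜ ∩ V) := by
      refine ⟨?_, h.closed.isOpen_compl.inter hV⟩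
      rw [← closure_subset_iff_isClosed]
      intro z hz
      have hzc : z ∈ closure Pᶜ := closure_mono inter_subset_left hz
      have hzP : z ∉ P := by
        intro hzP
        exact hemp ⟨z, by rw [frontier_eq_closure_inter_closure]; exact ⟨subset_closure hzP, hzc⟩, hz⟩
      refine ⟨hzP, ?_⟩
      rcases hsub hzP with h1 | h1
      · obtain ⟨w, hw, hw'⟩ := mem_closure_iff.1 hz U hU h1
        have : w ∈ Pᶜ ∩ (U ∩ V) := ⟨hw'.1, hw, hw'.2⟩
        rw [hdis] at this; exact absurd this (notMem_empty _)
      · exact h1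
    rcases isClopen_iff.1 hclop with h0 | h0
    · intro z hz
      rcases hsub hz with h1 | h1
      · exact h1
      · have : z ∈ Pᶜ ∩ V := ⟨hz, h1⟩
        rw [h0] at this; exact absurd this (notMem_empty _)
    · obtain ⟨p, hp⟩ := h.int_ne
      have : p ∈ Pᶜ ∩ V := by rw [h0]; trivial
      exact absurd (interior_subset hp) this.1
  by_cases h1 : (frontier P ∩ closure (Pᶜ ∩ V)).Nonempty
  · by_cases h2 : (frontier P ∩ closure (Pᶜ ∩ U)).Nonempty
    · exact absurd (isPreconnected_closed_iff.1 h.fr_preconn _ _ isClosed_closure isClosed_closure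
        hfc h2 h1) hdisj
    · right
      exact gen V U hV hU (by rwa [union_comm]) (by rwa [inter_comm V U]) h2
  · left
    exact gen U V hU hV hsub hdis h1

/-- filling -/
lemma SPR.fill {n : ℕ} [NeZero n] {P : Set (ℝ × ℝ)} {v : Fin n → ℝ × ℝ} (h : SPR P v)
    {S : Set (ℝ × ℝ)} (hb : Bornology.IsBounded S) (hf : frontier S ⊆ P) : S ⊆ P := by
  rcases preconn_dichotomy (P := S) h.compl_preconn (by
    rw [Set.disjoint_left]; intro w hw hw'; exact hw (hf hw')) with h1 | h1
  · exfalso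
    have hb2 : Bornology.IsBounded (univ : Set (ℝ × ℝ)) := by
      rw [← union_compl_self P]
      exact h.cpt.isBounded.union (hb.subset h1)
    exact NoncompactSpace.noncompact_univ (X := ℝ × ℝ) (Metric.isCompact_of_isClosed_isBounded isClosed_univ hb2)
  · intro s hs
    by_contra hc
    exact Set.disjoint_left.1 h1 hc hs


/-- closed triangle -/
def tri (A B C : ℝ × ℝ) : Set (ℝ × ℝ) :=
  {q | ∃ a b c : ℝ, 0 ≤ a ∧ 0 ≤ b ∧ 0 ≤ c ∧ a + b + c = 1 ∧ q = a • A + b • B + c • C}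

lemma tri_sub_convex {S : Set (ℝ × ℝ)} (hS : Convex ℝ S) {A B C : ℝ × ℝ} (hA : A ∈ S) (hB : B ∈ S)
    (hC : C ∈ S) : tri A B C ⊆ S := by
  rintro q ⟨a, b, c, ha, hb, hc, hs, rfl⟩
  rcases hb.eq_or_lt with h | h
  · subst h
    rw [zero_smul, add_zero]
    exact hS hA hC ha hc (by linarith)
  · have hab : 0 < a + b := by linarith
    have : a • A + b • B + c • C = (a+b) • ((a/(a+b)) • A + (b/(a+b)) • B) + c • C := by
      rw [smul_add, smul_smul, smul_smul, mul_div_cancel₀ _ hab.ne', mul_div_cancel₀ _ hab.ne']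
    rw [this]
    exact hS (hS hA hB (by positivity) (by positivity) (by field_simp)) hC hab.le hc hs

lemma DD_comb3 {p q A B C : ℝ × ℝ} {a b c : ℝ} (h : a + b + c = 1) :
    DD p q (a • A + b • B + c • C) = a * DD p q A + b * DD p q B + c * DD p q C := by
  obtain rfl : c = 1 - a - b := by linarith
  simp only [DD, Prod.fst_add, Prod.snd_add, Prod.smul_fst, Prod.smul_snd, smul_eq_mul]
  ring

lemma DD_left (a b : ℝ × ℝ) : DD a b a = 0 := by simp [DD]
lemma DD_right (a b : ℝ × ℝ) : DD a b b = 0 := by simp [DD]; ring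

/-- barycentric coordinates -/
lemma bary {A B C : ℝ × ℝ} (hD : DD A B C ≠ 0) :
    ∃ wa wb wc : ℝ × ℝ → ℝ, Continuous wa ∧ Continuous wb ∧ Continuous wc ∧
      (∀ q, wa q + wb q + wc q = 1 ∧ q = wa q • A + wb q • B + wc q • C) ∧
      (∀ a b c : ℝ, a + b + c = 1 → wa (a • A + b • B + c • C) = a ∧
        wb (a • A + b • B + c • C) = b ∧ wc (a • A + b • B + c • C) = c) := by
  have e1 : DD B C A = DD A B C := by simp [DD]; ring
  have e2 : DD C A B = DD A B C := by simp [DD]; ring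
  refine ⟨fun q => DD B C q / DD A B C, fun q => DD C A q / DD A B C, fun q => DD A B q / DD A B C,
    (DD_cont _ _).div_const _, (DD_cont _ _).div_const _, (DD_cont _ _).div_const _, ?_, ?_⟩
  · intro q
    constructor
    · field_simp
      simp only [DD]; ring
    · ext
      · simp only [Prod.smul_fst, Prod.fst_add, smul_eq_mul]
        field_simp
        simp only [DD]; ring
      · simp only [Prod.smul_snd, Prod.snd_add, smul_eq_mul]
        field_simp
        simp only [DD]; ring
  · intro a b c h
    refine ⟨?_, ?_, ?_⟩ <;> simp only [DD_comb3 h, DD_left, DD_right, e1, e2] <;> field_simp <;> ring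

lemma tri_compact (A B C : ℝ × ℝ) : IsCompact (tri A B C) := by
  have : tri A B C = (fun w : ℝ × ℝ × ℝ => w.1 • A + w.2.1 • B + w.2.2 • C) ''
      ((Icc 0 1 ×ˢ Icc 0 1 ×ˢ Icc 0 1) ∩ {w | w.1 + w.2.1 + w.2.2 = 1}) := by
    ext q
    constructor
    · rintro ⟨a, b, c, ha, hb, hc, hs, rfl⟩
      refine ⟨(a, b, c), ⟨⟨⟨ha, ?_⟩, ⟨hb, ?_⟩, ⟨hc, ?_⟩⟩, hs⟩, rfl⟩ <;> simp only <;> linarith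
    · rintro ⟨⟨a, b, c⟩, ⟨⟨⟨ha, _⟩, ⟨hb, _⟩, ⟨hc, _⟩⟩, hs⟩, rfl⟩
      exact ⟨a, b, c, ha, hb, hc, hs, rfl⟩
  rw [this]
  apply IsCompact.image
  · apply IsCompact.inter_right
    · exact isCompact_Icc.prod (isCompact_Icc.prod isCompact_Icc)
    · exact isClosed_eq (by fun_prop) continuous_const
  · fun_prop

lemma mem_seg_iff {A B q : ℝ × ℝ} : q ∈ segment ℝ A B ↔
    ∃ a b : ℝ, 0 ≤ a ∧ 0 ≤ b ∧ a + b = 1 ∧ a • A + b • B = q := Iff.rfl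

lemma col_cases {A B C : ℝ × ℝ} (hD : DD A B C = 0) :
    C ∈ segment ℝ A B ∨ B ∈ segment ℝ A C ∨ A ∈ segment ℝ B C := by
  by_cases hAB : A = B
  · subst hAB; exact Or.inr (Or.inl (left_mem_segment ℝ _ _))
  have hn : 0 < (B.1 - A.1) ^ 2 + (B.2 - A.2) ^ 2 := by
    by_contra hcon
    push Not at hcon
    apply hAB
    ext
    · nlinarith [sq_nonneg (B.1 - A.1), sq_nonneg (B.2 - A.2)]
    · nlinarith [sq_nonneg (B.1 - A.1), sq_nonneg (B.2 - A.2)]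
  set N := (B.1 - A.1) ^ 2 + (B.2 - A.2) ^ 2
  obtain ⟨m, hm⟩ : ∃ m : ℝ, C = (1 - m) • A + m • B := by
    refine ⟨((B.1 - A.1) * (C.1 - A.1) + (B.2 - A.2) * (C.2 - A.2)) / N, ?_⟩
    simp only [DD] at hD
    ext
    · simp only [Prod.smul_fst, Prod.fst_add, smul_eq_mul]
      field_simp
      simp only [N]
      linear_combination (-(B.2 - A.2)) * hD
    · simp only [Prod.smul_snd, Prod.snd_add, smul_eq_mul]
      field_simp
      simp only [N]
      linear_combination (B.1 - A.1) * hD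
  rcases lt_or_ge m 0 with h | h
  · right; right
    have h1 : 0 < 1 - m := by linarith
    refine ⟨-m / (1-m), 1 / (1 - m), div_nonneg (by linarith) h1.le, by positivity, by field_simp; ring, ?_⟩
    rw [hm]
    ext
    · simp only [Prod.smul_fst, Prod.fst_add, smul_eq_mul]
      field_simp; ring
    · simp only [Prod.smul_snd, Prod.snd_add, smul_eq_mul]
      field_simp; ring
  rcases le_or_gt m 1 with h1 | h1
  · left
    exact ⟨1 - m, m, by linarith, h, by ring, hm.symm⟩
  · right; left
    have h2 : 0 < m := by linarith
    refine ⟨(m - 1) / m, 1 / m, div_nonneg (by linarith) h2.le, by positivity, by field_simp; ring, ?_⟩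
    rw [hm]
    ext
    · simp only [Prod.smul_fst, Prod.fst_add, smul_eq_mul]
      field_simp; ring
    · simp only [Prod.smul_snd, Prod.snd_add, smul_eq_mul]
      field_simp; ring

lemma SPR.TL {n : ℕ} [NeZero n] {P : Set (ℝ × ℝ)} {v : Fin n → ℝ × ℝ} (h : SPR P v)
    {A B C : ℝ × ℝ} (hAB : segment ℝ A B ⊆ P) (hBC : segment ℝ B C ⊆ P) (hAC : segment ℝ A C ⊆ P) :
    tri A B C ⊆ P := by
  by_cases hD : DD A B C = 0
  · rcases col_cases hD with h1 | h1 | h1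
    · exact (tri_sub_convex (convex_segment A B) (left_mem_segment ℝ _ _) (right_mem_segment ℝ _ _)
        h1).trans hAB
    · exact (tri_sub_convex (convex_segment A C) (left_mem_segment ℝ _ _) h1
        (right_mem_segment ℝ _ _)).trans hAC
    · exact (tri_sub_convex (convex_segment B C) h1 (left_mem_segment ℝ _ _)
        (right_mem_segment ℝ _ _)).trans hBC
  · apply h.fill (tri_compact A B C).isBounded
    obtain ⟨wa, wb, wc, ca, cb, cc, hw, hu⟩ := bary hD
    rw [(tri_compact A B C).isClosed.frontier_eq]
    rintro q ⟨⟨a, b, c, ha, hb, hc, hs, hq⟩, hqi⟩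
    rcases ha.eq_or_lt with h1 | h1
    · apply hBC
      rw [hq, ← h1, zero_smul, zero_add]
      exact ⟨b, c, hb, hc, by linarith, rfl⟩
    rcases hb.eq_or_lt with h2 | h2
    · apply hAC
      rw [hq, ← h2, zero_smul, add_zero]
      exact ⟨a, c, ha, hc, by linarith, rfl⟩
    rcases hc.eq_or_lt with h3 | h3
    · apply hAB
      rw [hq, ← h3, zero_smul, add_zero]
      exact ⟨a, b, ha, hb, by linarith, rfl⟩
    exfalso
    apply hqi
    rw [mem_interior]
    refine ⟨{q | 0 < wa q} ∩ {q | 0 < wb q} ∩ {q | 0 < wc q}, ?_, ?_, ?_⟩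
    · rintro z ⟨⟨z1, z2⟩, z3⟩
      exact ⟨wa z, wb z, wc z, z1.le, z2.le, z3.le, (hw z).1, (hw z).2⟩
    · exact ((isOpen_lt continuous_const ca).inter (isOpen_lt continuous_const cb)).inter
        (isOpen_lt continuous_const cc)
    · obtain ⟨u1, u2, u3⟩ := hu a b c hs
      rw [hq]
      exact ⟨⟨by simpa [u1] using h1, by simpa [u2] using h2⟩, by simpa [u3] using h3⟩

lemma SPR.DL {n : ℕ} [NeZero n] {P : Set (ℝ × ℝ)} {v : Fin n → ℝ × ℝ} (h : SPR P v)
    {A B C D : ℝ × ℝ} (hAB : segment ℝ A B ⊆ P) (hBC : segment ℝ B C ⊆ P)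
    (hCD : segment ℝ C D ⊆ P) (hDA : segment ℝ D A ⊆ P) (hopp : DD A C B * DD A C D < 0) :
    segment ℝ A C ⊆ P := by
  have fB : DD A C B ≠ 0 := by intro h0; rw [h0] at hopp; simp at hopp
  have fD : DD A C D ≠ 0 := by intro h0; rw [h0] at hopp; simp at hopp
  obtain ⟨wa, wc, wb, ca, cc, cb, hw, hu⟩ := bary fB
  obtain ⟨ya, yc, yd, ka, kc, kd, hy, hz⟩ := bary fD
  have rel : ∀ q, wb q * DD A C B = yd q * DD A C D := by
    intro q
    have e1 : DD A C q = wb q * DD A C B := by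
      conv_lhs => rw [(hw q).2]
      rw [DD_comb3 (hw q).1, DD_left, DD_right]; ring
    have e2 : DD A C q = yd q * DD A C D := by
      conv_lhs => rw [(hy q).2]
      rw [DD_comb3 (hy q).1, DD_left, DD_right]; ring
    rw [← e1, e2]
  have rel2 : ∀ q, yd q * (DD A C D) ^ 2 = wb q * (DD A C B * DD A C D) := by
    intro q; linear_combination (-DD A C D) * rel q
  have hD2 : 0 < (DD A C D) ^ 2 := by positivity
  set S := tri A C B ∪ tri A C D with hS
  have hcS : IsCompact S := (tri_compact _ _ _).union (tri_compact _ _ _)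
  have hSP : S ⊆ P := by
    apply h.fill hcS.isBounded
    rw [hcS.isClosed.frontier_eq]
    have hopen : IsOpen (({q | wb q < 0} ∪ ({q | 0 < wa q} ∩ {q | 0 < wc q})) ∩
        ({q | yd q < 0} ∪ ({q | 0 < ya q} ∩ {q | 0 < yc q}))) :=
      ((isOpen_lt cb continuous_const).union ((isOpen_lt continuous_const ca).inter
        (isOpen_lt continuous_const cc))).inter
       ((isOpen_lt kd continuous_const).union ((isOpen_lt continuous_const ka).inter
        (isOpen_lt continuous_const kc)))
    have hsub : (({q | wb q < 0} ∪ ({q | 0 < wa q} ∩ {q | 0 < wc q})) ∩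
        ({q | yd q < 0} ∪ ({q | 0 < ya q} ∩ {q | 0 < yc q}))) ⊆ S := by
      rintro q ⟨h1, h2⟩
      simp only [mem_union, mem_inter_iff, mem_ofPred_eq] at h1 h2
      have r := rel2 q
      rcases lt_or_ge (wb q) 0 with hb | hb
      · have : 0 < yd q := by
          by_contra hc; push Not at hc
          nlinarith [mul_pos_of_neg_of_neg hb hopp]
        rcases h2 with h2 | h2
        · linarith
        · right
          exact ⟨_, _, _, h2.1.le, h2.2.le, this.le, (hy q).1, (hy q).2⟩
      · rcases h1 with h1 | h1
        · linarith
        · left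
          exact ⟨_, _, _, h1.1.le, h1.2.le, hb, (hw q).1, (hw q).2⟩
    rintro q ⟨hqS, hqi⟩
    by_contra hqP
    apply hqi
    apply interior_maximal hsub hopen
    rcases hqS with ⟨a, c, b, ha, hc, hb, hs, hq⟩ | ⟨a, c, d, ha, hc, hd, hs, hq⟩
    · have ha' : 0 < a := by
        rcases ha.eq_or_lt with h1 | h1
        · exfalso; apply hqP; apply hBC
          rw [hq, ← h1, zero_smul, zero_add, segment_symm]
          exact ⟨c, b, hc, hb, by linarith, rfl⟩
        · exact h1
      have hc' : 0 < c := by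
        rcases hc.eq_or_lt with h1 | h1
        · exfalso; apply hqP; apply hAB
          rw [hq, ← h1, zero_smul, add_zero]
          exact ⟨a, b, ha, hb, by linarith, rfl⟩
        · exact h1
      obtain ⟨u1, u2, u3⟩ := hu a c b hs
      rw [← hq] at u1 u2 u3
      refine ⟨Or.inr ⟨by simpa [u1] using ha', by simpa [u2] using hc'⟩, ?_⟩
      rcases hb.eq_or_lt with h1 | h1
      · right
        have hq2 : q = a • A + c • C + (0:ℝ) • D := by rw [hq, ← h1]; simp
        obtain ⟨t1, t2, t3⟩ := hz a c 0 (by linarith)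
        rw [← hq2] at t1 t2
        exact ⟨by simpa [t1] using ha', by simpa [t2] using hc'⟩
      · left
        have r := rel2 q
        rw [u3] at r
        simp only [mem_ofPred_eq]
        by_contra hcon; push Not at hcon
        nlinarith
    · have ha' : 0 < a := by
        rcases ha.eq_or_lt with h1 | h1
        · exfalso; apply hqP; apply hCD
          rw [hq, ← h1, zero_smul, zero_add]
          exact ⟨c, d, hc, hd, by linarith, rfl⟩
        · exact h1
      have hc' : 0 < c := by
        rcases hc.eq_or_lt with h1 | h1
        · exfalso; apply hqP; apply hDA
          rw [hq, ← h1, zero_smul, add_zero, segment_symm]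
          exact ⟨a, d, ha, hd, by linarith, rfl⟩
        · exact h1
      obtain ⟨u1, u2, u3⟩ := hz a c d hs
      rw [← hq] at u1 u2 u3
      refine ⟨?_, Or.inr ⟨by simpa [u1] using ha', by simpa [u2] using hc'⟩⟩
      rcases hd.eq_or_lt with h1 | h1
      · right
        have hq2 : q = a • A + c • C + (0:ℝ) • B := by rw [hq, ← h1]; simp
        obtain ⟨t1, t2, t3⟩ := hu a c 0 (by linarith)
        rw [← hq2] at t1 t2
        exact ⟨by simpa [t1] using ha', by simpa [t2] using hc'⟩
      · left
        have r := rel2 q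
        rw [u3] at r
        simp only [mem_ofPred_eq]
        by_contra hcon; push Not at hcon
        nlinarith [mul_pos h1 hD2, mul_nonneg hcon (neg_nonneg.2 hopp.le)]
  rintro q ⟨a, c, ha, hc, hs, rfl⟩
  apply hSP
  left
  exact ⟨a, c, 0, ha, hc, le_rfl, by linarith, by simp⟩


structure WVR {n : ℕ} [NeZero n] (P : Set (ℝ × ℝ)) (v : Fin n → ℝ × ℝ) (α β : ℝ) : Prop
    extends SPR P v where
  ab : α < β
  base : segment ℝ (v (-1)) (v 0) = segment ℝ ((α, 0) : ℝ × ℝ) (β, 0)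
  half : ∀ p ∈ P, 0 ≤ p.2
  wv : ∀ p ∈ P, ∃ y : ℝ, α ≤ y ∧ y ≤ β ∧ segment ℝ p (y, 0) ⊆ P

lemma tri_convex (A B C : ℝ × ℝ) : Convex ℝ (tri A B C) := by
  rintro p ⟨a, b, c, ha, hb, hc, hs, rfl⟩ q ⟨a', b', c', ha', hb', hc', hs', rfl⟩ s t h1 h2 h3
  refine ⟨s * a + t * a', s * b + t * b', s * c + t * c', by positivity, by positivity,
    by positivity, ?_, ?_⟩
  · linear_combination s * hs + t * hs' + h3
  · module

lemma tri_mem1 (A B C : ℝ × ℝ) : A ∈ tri A B C := ⟨1, 0, 0, by simp, by simp, by simp, by simp, by simp⟩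
lemma tri_mem2 (A B C : ℝ × ℝ) : B ∈ tri A B C := ⟨0, 1, 0, by simp, by simp, by simp, by simp, by simp⟩
lemma tri_mem3 (A B C : ℝ × ℝ) : C ∈ tri A B C := ⟨0, 0, 1, by simp, by simp, by simp, by simp, by simp⟩

lemma seg_sub {a b c d : ℝ × ℝ} (hc : c ∈ segment ℝ a b) (hd : d ∈ segment ℝ a b) :
    segment ℝ c d ⊆ segment ℝ a b := (convex_segment a b).segment_subset hc hd

lemma base_mem {α β y : ℝ} (h1 : α ≤ y) (h2 : y ≤ β) :
    ((y, 0) : ℝ × ℝ) ∈ segment ℝ ((α, 0) : ℝ × ℝ) (β, 0) := by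
  rcases h1.eq_or_lt with h | h
  · subst h; exact left_mem_segment ℝ _ _
  · have : 0 < β - α := by linarith
    refine ⟨(β - y) / (β - α), (y - α) / (β - α), div_nonneg (by linarith) this.le,
      div_nonneg (by linarith) this.le, by field_simp; ring, ?_⟩
    ext
    · simp; field_simp; ring
    · simp

namespace WVR
variable {n : ℕ} [NeZero n] {P : Set (ℝ × ℝ)} {v : Fin n → ℝ × ℝ} {α β : ℝ}

lemma base_sub (h : WVR P v α β) {y l : ℝ} (h1 : α ≤ y) (h2 : y ≤ β) (h3 : α ≤ l) (h4 : l ≤ β) :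
    segment ℝ ((y, 0) : ℝ × ℝ) (l, 0) ⊆ P := by
  refine (seg_sub (base_mem h1 h2) (base_mem h3 h4)).trans ?_
  rw [← h.base]
  have := h.edge_fr (-1)
  rw [neg_add_cancel] at this
  exact this.trans h.fr_sub

lemma ends (h : WVR P v α β) : (v (-1)).2 = 0 ∧ (v 0).2 = 0 := by
  have key : ∀ q : ℝ × ℝ, q ∈ segment ℝ ((α, 0) : ℝ × ℝ) (β, 0) → q.2 = 0 := by
    rintro q ⟨a, b, _, _, _, rfl⟩; simp
  constructor
  · apply key; rw [← h.base]; exact left_mem_segment ℝ _ _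
  · apply key; rw [← h.base]; exact right_mem_segment ℝ _ _

lemma vertex_lemma (h : WVR P v α β) {g : ℝ × ℝ} {l y t' : ℝ} (hl1 : α ≤ l) (hl2 : l ≤ β)
    (hy1 : α ≤ y) (hy2 : y ≤ β) (hgl : segment ℝ g (l, 0) ⊆ P) (hgy : ¬ segment ℝ g (y, 0) ⊆ P)
    (ht0 : 0 ≤ t') (ht1 : t' < 1)
    (hk : segment ℝ ((1 - t') • g + t' • ((l, 0) : ℝ × ℝ)) (y, 0) ⊆ P) :
    ∃ i, ∀ q ∈ tri ((1 - t') • g + t' • ((l, 0) : ℝ × ℝ)) (y, 0) (l, 0), segment ℝ (v i) q ⊆ P := by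
  set L : ℝ × ℝ := (l, 0) with hL
  set Y : ℝ × ℝ := (y, 0) with hY
  set m : ℝ → ℝ × ℝ := fun t => (1 - t) • g + t • L with hm
  have hmm : ∀ t, 0 ≤ t → t ≤ 1 → m t ∈ segment ℝ g L := fun t a b =>
    ⟨1 - t, t, by linarith, a, by ring, rfl⟩
  have hYL : segment ℝ Y L ⊆ P := h.base_sub hy1 hy2 hl1 hl2
  -- minimal parameter
  obtain ⟨t0, ⟨⟨ht00, ht01⟩, hst⟩, hmin⟩ : ∃ t0, IsLeast {t : ℝ | t ∈ Icc (0:ℝ) 1 ∧ segment ℝ (m t) Y ⊆ P} t0 := by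
    have hcl : IsCompact {t : ℝ | t ∈ Icc (0:ℝ) 1 ∧ segment ℝ (m t) Y ⊆ P} := by
      have e : {t : ℝ | t ∈ Icc (0:ℝ) 1 ∧ segment ℝ (m t) Y ⊆ P} =
          Icc (0:ℝ) 1 ∩ ⋂ u ∈ Icc (0:ℝ) 1, {t | (1 - u) • m t + u • Y ∈ P} := by
        ext t
        simp only [mem_ofPred_eq, mem_inter_iff, mem_iInter, segment_eq_image, image_subset_iff]
        rfl
      rw [e]
      apply isCompact_Icc.inter_right
      apply isClosed_biInter
      intro u _
      exact h.closed.preimage (by fun_prop)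
    exact hcl.exists_isLeast ⟨t', ⟨ht0, ht1.le⟩, hk⟩
  have htt : t0 ≤ t' := hmin ⟨⟨ht0, ht1.le⟩, hk⟩
  have ht0pos : 0 < t0 := by
    rcases ht00.eq_or_lt with h0 | h0
    · exfalso; apply hgy
      rw [← h0] at hst
      simpa [hm] using hst
    · exact h0
  have ht01' : t0 < 1 := by linarith
  have hm0 : m t0 ∈ segment ℝ g L := hmm _ ht00 ht01
  have hT : tri (m t0) Y L ⊆ P := h.TL hst hYL ((seg_sub hm0 (right_mem_segment ℝ _ _)).trans hgl)
  have hsubT : tri (m t') Y L ⊆ tri (m t0) Y L := by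
    apply tri_sub_convex (tri_convex _ _ _) _ (tri_mem2 _ _ _) (tri_mem3 _ _ _)
    have h1 : 0 < 1 - t0 := by linarith
    refine ⟨(1 - t') / (1 - t0), 0, (t' - t0) / (1 - t0), div_nonneg (by linarith) h1.le, le_rfl,
      div_nonneg (by linarith) h1.le, by field_simp; ring, ?_⟩
    simp only [hm]
    ext
    · simp only [Prod.smul_fst, Prod.fst_add, smul_eq_mul]
      field_simp; ring
    · simp only [Prod.smul_snd, Prod.snd_add, smul_eq_mul]
      field_simp; ring
  by_cases hver : ∃ i, v i ∈ segment ℝ (m t0) Y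
  · obtain ⟨i, hi⟩ := hver
    refine ⟨i, fun q hq => ?_⟩
    refine Subset.trans ?_ hT
    apply (tri_convex _ _ _).segment_subset _ (hsubT hq)
    exact (tri_convex _ _ _).segment_subset (tri_mem1 _ _ _) (tri_mem2 _ _ _) hi
  exfalso
  push Not at hver
  -- local statement
  have hloc : ∀ p ∈ segment ℝ (m t0) Y, ∀ᶠ q in 𝓝 p, q ∈ tri g Y L → q ∈ P := by
    intro p hp
    have hpP : p ∈ P := hst hp
    by_cases hpf : p ∈ frontier P
    swap
    · have : p ∈ interior P := by
        by_contra hc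
        exact hpf ⟨subset_closure hpP, hc⟩
      filter_upwards [isOpen_interior.mem_nhds this] with q hq _
      exact interior_subset hq
    have hpv : p ∉ range v := by
      rintro ⟨i, rfl⟩; exact hver i hp
    have hpf' := hpf
    rw [h.fr, mem_iUnion] at hpf'
    obtain ⟨i, hi⟩ := hpf'
    obtain ⟨r, hr, s, hrs⟩ := h.local_half hi hpv
    set φ : ℝ × ℝ → ℝ := fun q => s * DD (v i) (v (i+1)) q with hφ
    have φc : ∀ (a b : ℝ) (x z : ℝ × ℝ), a + b = 1 → φ (a • x + b • z) = a * φ x + b * φ z := by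
      intro a b x z hab
      simp only [hφ, DD_comb hab]; ring
    have φ0 : φ p = 0 := by
      obtain ⟨a, b, _, _, hab, rfl⟩ := hi
      rw [φc a b _ _ hab]
      simp [hφ, DD_left, DD_right]
    have φpos : ∀ z, segment ℝ p z ⊆ P → 0 ≤ φ z := by
      intro z hz
      have : Tendsto (fun ε : ℝ => (1 - ε) • p + ε • z) (𝓝[>] 0) (𝓝 p) := by
        have : Continuous (fun ε : ℝ => (1 - ε) • p + ε • z) := by fun_prop
        have h0 := this.tendsto 0
        simp only [sub_zero, one_smul, zero_smul, add_zero] at h0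
        exact h0.mono_left nhdsWithin_le_nhds
      have h3 := this.eventually (ball_mem_nhds p hr)
      have h4 : ∀ᶠ ε : ℝ in 𝓝[>] 0, ε < 1 :=
        nhdsWithin_le_nhds (Iio_mem_nhds one_pos)
      obtain ⟨ε, ⟨h5, h6⟩, h7⟩ := ((h3.and h4).and self_mem_nhdsWithin).exists
      have h7' : 0 < ε := h7
      have h8 : (1 - ε) • p + ε • z ∈ P := hz ⟨1 - ε, ε, by linarith, h7'.le, by ring, rfl⟩
      have h9 := (hrs _ h5).1 h8
      change 0 ≤ φ _ at h9
      rw [φc _ _ _ _ (by ring), φ0] at h9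
      by_contra hc
      push Not at hc
      nlinarith
    have φY : 0 ≤ φ Y := φpos _ ((seg_sub hp (right_mem_segment ℝ _ _)).trans hst)
    have φm : 0 ≤ φ (m t0) := φpos _ ((seg_sub hp (left_mem_segment ℝ _ _)).trans hst)
    have hpT : p ∈ tri (m t0) Y L :=
      (tri_convex _ _ _).segment_subset (tri_mem1 _ _ _) (tri_mem2 _ _ _) hp
    have φL : 0 ≤ φ L := φpos _
      (((tri_convex _ _ _).segment_subset hpT (tri_mem3 _ _ _)).trans hT)
    have φg : 0 ≤ φ g := by
      obtain ⟨a, b, ha, hb, hab, hpe⟩ := hp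
      rcases hb.eq_or_lt with hb0 | hb0
      · have : p = m t0 := by
          rw [← hpe, ← hb0, show a = 1 by linarith]; simp
        apply φpos
        rw [this]
        exact (seg_sub hm0 (left_mem_segment ℝ _ _)).trans hgl
      · have hφY0 : φ Y = 0 := by
          have := φc a b (m t0) Y hab
          rw [hpe, φ0] at this
          nlinarith [mul_nonneg ha φm, mul_nonneg hb φY]
        -- Y lies on the edge i
        have hYe : Y ∈ segment ℝ (v i) (v (i+1)) := by
          by_cases hs0 : s = 0
          · exfalso
            -- then P contains a ball around p
            apply hpf.2
            rw [mem_interior]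
            refine ⟨ball p r, fun q hq => ?_, isOpen_ball, mem_ball_self hr⟩
            rw [hrs q hq, hs0]; simp
          have hDY : DD (v i) (v (i+1)) Y = 0 := by
            rcases mul_eq_zero.1 hφY0 with h1 | h1
            · exact absurd h1 hs0
            · exact h1
          have hpY : segment ℝ p Y ⊆ segment ℝ (m t0) Y :=
            seg_sub ⟨a, b, ha, hb, hab, hpe⟩ (right_mem_segment ℝ _ _)
          have hwp := mem_segment_iff_wbtw.1 hi
          rcases col_cases hDY with h1 | h1 | h1
          · exact h1
          · exfalso
            apply hver (i+1)
            apply hpY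
            rw [mem_segment_iff_wbtw] at h1 ⊢
            exact h1.trans_left_right hwp
          · exfalso
            apply hver i
            apply hpY
            rw [mem_segment_iff_wbtw] at h1 ⊢
            exact h1.trans_left_right hwp.symm
        have hYb : Y ∈ segment ℝ (v (-1)) (v (-1+1)) := by
          rw [neg_add_cancel, h.base]; exact base_mem hy1 hy2
        have hi1 : i = -1 := by
          by_contra hne
          rcases h.two_edges hne hYe hYb with h1 | h1
          · apply hver (i+1); rw [← h1.2]; exact right_mem_segment ℝ _ _
          · apply hver (-1+1); rw [← h1.2]; exact right_mem_segment ℝ _ _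
        have hφL0 : φ L = 0 := by
          simp only [hφ, hi1, neg_add_cancel]
          simp [DD, h.ends.1, h.ends.2, hL]
        have := φc (1 - t0) t0 g L (by ring)
        rw [hφL0] at this
        change φ (m t0) = _ at this
        by_contra hc
        push Not at hc
        nlinarith
    filter_upwards [ball_mem_nhds p hr] with q hq hqT
    rw [hrs q hq]
    obtain ⟨a, b, c, ha, hb, hc, hs, rfl⟩ := hqT
    have : s * DD (v i) (v (i+1)) (a • g + b • Y + c • L) = a * φ g + b * φ Y + c * φ L := by
      rw [DD_comb3 hs]; simp only [hφ]; ring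
    rw [this]
    positivity
  have hcomp := isCompact_Icc.eventually_forall_of_forall_eventually (x₀ := t0)
    (K := Icc (0:ℝ) 1) (P := fun t u => (1 - u) • m t + u • Y ∈ tri g Y L → (1 - u) • m t + u • Y ∈ P) (by
      intro u hu
      have h1 := hloc ((1 - u) • m t0 + u • Y) ⟨1 - u, u, by linarith [hu.2], hu.1, by ring, rfl⟩
      have hc : Continuous (fun z : ℝ × ℝ => (1 - z.2) • m z.1 + z.2 • Y) := by fun_prop
      exact (hc.tendsto (t0, u)).eventually h1)
  obtain ⟨t, ⟨ht, htl⟩, htp⟩ : ∃ t, ((∀ u ∈ Icc (0:ℝ) 1, (1 - u) • m t + u • Y ∈ tri g Y L →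
      (1 - u) • m t + u • Y ∈ P) ∧ t < t0) ∧ 0 < t := by
    have h1 : ∀ᶠ t in 𝓝[<] t0, 0 < t := nhdsWithin_le_nhds (Ioi_mem_nhds ht0pos)
    have h2 : ∀ᶠ t in 𝓝[<] t0, t < t0 := self_mem_nhdsWithin
    exact (((hcomp.filter_mono nhdsWithin_le_nhds).and h2).and h1).exists
  have : t0 ≤ t := hmin ⟨⟨htp.le, by linarith⟩, by
    rw [segment_eq_image]
    rintro _ ⟨u, hu, rfl⟩
    apply ht u hu
    apply (tri_convex _ _ _).segment_subset _ (tri_mem2 _ _ _)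
      ⟨1 - u, u, by linarith [hu.2], hu.1, by ring, rfl⟩
    exact (tri_convex _ _ _).segment_subset (tri_mem1 _ _ _) (tri_mem3 _ _ _)
      (hmm t htp.le (by linarith))⟩
  linarith

end WVR


lemma seg_cover {a b x : ℝ × ℝ} (hx : x ∈ segment ℝ a b) :
    segment ℝ a b ⊆ segment ℝ a x ∪ segment ℝ x b := by
  intro q hq
  rw [segment_eq_image_lineMap] at hx hq
  obtain ⟨t, ht, rfl⟩ := hx
  obtain ⟨u, hu, rfl⟩ := hq
  rcases le_total u t with hut | hut
  · left
    rw [mem_segment_iff_wbtw]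
    have : Wbtw ℝ 0 u t := Wbtw.of_le_of_le hu.1 hut
    have := this.map (AffineMap.lineMap a b)
    simpa using this
  · right
    rw [mem_segment_iff_wbtw]
    have : Wbtw ℝ t u 1 := Wbtw.of_le_of_le hut hu.2
    have := this.map (AffineMap.lineMap a b)
    simpa using this

lemma seg_join {P : Set (ℝ × ℝ)} {a b x : ℝ × ℝ} (hx : x ∈ segment ℝ a b)
    (h1 : segment ℝ a x ⊆ P) (h2 : segment ℝ x b ⊆ P) : segment ℝ a b ⊆ P :=
  (seg_cover hx).trans (union_subset h1 h2)

lemma tri_seg {A B C p q : ℝ × ℝ} (hp : p ∈ tri A B C) (hq : q ∈ tri A B C) :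
    segment ℝ p q ⊆ tri A B C := (tri_convex A B C).segment_subset hp hq

lemma symm_sub {P : Set (ℝ × ℝ)} {a b : ℝ × ℝ} (h : segment ℝ a b ⊆ P) : segment ℝ b a ⊆ P := by
  rwa [segment_symm]

lemma SPR.lemmaL {n : ℕ} [NeZero n] {P : Set (ℝ × ℝ)} {v : Fin n → ℝ × ℝ} (h : SPR P v)
    {y l : ℝ} {g m x : ℝ × ℝ} (hYL : segment ℝ ((y, 0) : ℝ × ℝ) (l, 0) ⊆ P)
    (hgL : segment ℝ g (l, 0) ⊆ P) (hgY : ¬ segment ℝ g (y, 0) ⊆ P)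
    (hx : x ∈ segment ℝ ((y, 0) : ℝ × ℝ) m) (hx2 : 0 < x.2) (hg2 : 0 ≤ g.2)
    (hYm : segment ℝ ((y, 0) : ℝ × ℝ) m ⊆ P)
    (hgm : segment ℝ g m ⊆ P) (hgx : ¬ segment ℝ g x ⊆ P) :
    ∃ o ∈ segment ℝ g (l, 0), x ∈ segment ℝ ((y, 0) : ℝ × ℝ) o ∧
      segment ℝ ((y, 0) : ℝ × ℝ) o ⊆ P := by
  set Y : ℝ × ℝ := (y, 0) with hY
  set L : ℝ × ℝ := (l, 0) with hL
  obtain ⟨w, t, hw, ht, hwt, hxe⟩ := hx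
  obtain rfl : w = 1 - t := by linarith
  have hx2' : x.2 = t * m.2 := by rw [← hxe]; simp [hY]
  have ht0 : 0 < t := by
    rcases ht.eq_or_lt with h0 | h0
    · rw [← h0] at hx2'; linarith
    · exact h0
  have hm2 : 0 < m.2 := by
    by_contra hc; push Not at hc
    nlinarith
  have colcontra : ∀ z, segment ℝ Y z ⊆ P → segment ℝ z g ⊆ P → DD Y g z ≠ 0 := by
    intro z h1 h2 h0
    rcases col_cases h0 with h3 | h3 | h3
    · exact hgY (symm_sub (seg_join h3 h1 h2))
    · exact hgY (symm_sub ((seg_sub (left_mem_segment ℝ _ _) h3).trans h1))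
    · rw [segment_symm] at h3
      exact hgY ((segment_symm ℝ Y g ▸ (seg_sub h3 (right_mem_segment ℝ _ _))).trans h2)
  have hD1 : DD Y g m ≠ 0 := colcontra m hYm (symm_sub hgm)
  have hD2 : DD Y g L ≠ 0 := colcontra L hYL (symm_sub hgL)
  have hpos : 0 < DD Y g m * DD Y g L := by
    rcases lt_or_gt_of_ne (mul_ne_zero hD1 hD2) with h0 | h0
    · exfalso
      exact hgY (symm_sub (h.DL hYm (symm_sub hgm) hgL (symm_sub hYL) h0))
    · exact h0
  have eL : ∀ p, DD Y p L = - (p.2 * (l - y)) := by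
    intro p; simp [DD, hY, hL]
  have hg2' : 0 < g.2 := by
    rcases hg2.eq_or_lt with h0 | h0
    · exfalso; apply hD2; rw [eL, ← h0]; simp
    · exact h0
  have eA : DD Y m g = - DD Y g m := by simp [DD]; ring
  set A := DD Y m g with hA
  set B := DD Y m L with hB
  have hAB : A * B < 0 := by
    have e1 : B * g.2 = DD Y g L * m.2 := by rw [hB, eL, eL]; ring
    have : A * B * g.2 = - (DD Y g m * DD Y g L) * m.2 := by
      rw [mul_assoc, e1, eA]; ring
    by_contra hc; push Not at hc
    nlinarith [mul_nonneg hc hg2'.le, mul_pos hpos hm2]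
  have hB0 : B ≠ 0 := by intro h0; rw [h0] at hAB; simp at hAB
  have hBA : 0 < B * (B - A) := by nlinarith [sq_nonneg B]
  have hBA0 : B - A ≠ 0 := by intro h0; rw [h0] at hBA; simp at hBA
  set lam := B / (B - A) with hlam
  have hlam0 : 0 < lam := by
    rw [hlam, show B / (B - A) = B * (B - A) / (B-A)^2 by field_simp]; positivity
  have hlam1 : 1 - lam = -(A * B) / (B * (B - A)) := by rw [hlam]; field_simp; ring
  have hlam1' : 0 < 1 - lam := by rw [hlam1]; exact div_pos (by linarith) hBA
  set o : ℝ × ℝ := lam • g + (1 - lam) • L with ho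
  have hoS : o ∈ segment ℝ g L := ⟨lam, 1 - lam, hlam0.le, hlam1'.le, by ring, rfl⟩
  have hgo : segment ℝ g o ⊆ P := (seg_sub (left_mem_segment ℝ _ _) hoS).trans hgL
  have hDo : DD Y m o = 0 := by
    rw [ho, DD_comb (by ring), ← hA, ← hB, hlam]; field_simp; ring
  have ho2 : 0 < o.2 := by
    rw [ho]; simp [hL]; positivity
  set ρ := o.2 / m.2 with hρ
  have hρ0 : 0 < ρ := by positivity
  have hoe : o = (1 - ρ) • Y + ρ • m := by
    have : (m.1 - y) * o.2 = m.2 * (o.1 - y) := by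
      have := hDo; simp [DD, hY] at this; linarith
    ext
    · simp only [Prod.smul_fst, Prod.fst_add, smul_eq_mul, hρ, hY]
      field_simp
      linear_combination -this
    · simp only [Prod.smul_snd, Prod.snd_add, smul_eq_mul, hρ, hY]
      field_simp; ring
  refine ⟨o, hoS, ?_⟩
  have hxo : t ≤ ρ → x ∈ segment ℝ Y o := by
    intro htr
    refine ⟨1 - t / ρ, t / ρ, ?_, by positivity, by ring, ?_⟩
    · rw [sub_nonneg, div_le_one hρ0]; exact htr
    · rw [hoe, ← hxe]
      ext
      · simp only [Prod.smul_fst, Prod.fst_add, smul_eq_mul]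
        field_simp; ring
      · simp only [Prod.smul_snd, Prod.snd_add, smul_eq_mul]
        field_simp; ring
  rcases lt_or_ge 1 ρ with hr1 | hr1
  · refine ⟨hxo (by linarith), ?_⟩
    have hme : m = (1 - 1 / ρ) • Y + (1 / ρ) • o := by
      rw [hoe]
      ext
      · simp only [Prod.smul_fst, Prod.fst_add, smul_eq_mul]
        field_simp; ring
      · simp only [Prod.smul_snd, Prod.snd_add, smul_eq_mul]
        field_simp; ring
    have hmL : segment ℝ m L ⊆ P := by
      apply h.DL (symm_sub hgm) hgL (symm_sub hYL) hYm
      have e1 : DD m L Y = B := by simp [hB, DD]; ring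
      have e2 : (ρ - 1) * DD m L Y + lam * DD m L g = 0 := by
        have h1 : DD m L o = lam * DD m L g := by
          rw [ho, DD_comb (by ring), DD_right]; ring
        have h2 : DD m L m = (1 - 1 / ρ) * DD m L Y + (1 / ρ) * DD m L o := by
          have h5 := DD_comb (a := m) (b := L) (p := Y) (q := o) (show (1 - 1 / ρ) + 1 / ρ = 1 by ring)
          rwa [← hme] at h5
        rw [DD_left, h1] at h2
        have h3 : ρ * ((1 - 1 / ρ) * DD m L Y + 1 / ρ * (lam * DD m L g)) = 0 := by rw [← h2]; simp
        rw [← h3]; field_simp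
      have e3 : lam * (DD m L g * DD m L Y) = - ((ρ - 1) * B ^ 2) := by
        rw [e1] at e2 ⊢; linear_combination B * e2
      have : 0 < (ρ - 1) * B ^ 2 := by
        have : 0 < ρ - 1 := by linarith
        positivity
      by_contra hc; push Not at hc
      nlinarith [mul_nonneg hlam0.le hc]
    have hT := h.TL hgm hmL hgL
    refine seg_join (x := m) ?_ hYm ?_
    · rw [hme]
      have h0 : 1 / ρ ≤ 1 := by rw [div_le_one hρ0]; exact hr1.le
      exact ⟨1 - 1 / ρ, 1 / ρ, by linarith, by positivity, by ring, rfl⟩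
    · exact (tri_seg (tri_mem2 _ _ _) (tri_seg (tri_mem1 _ _ _) (tri_mem3 _ _ _) hoS)).trans hT
  · have hoY : o ∈ segment ℝ Y m := by
      rw [hoe]; exact ⟨1 - ρ, ρ, by linarith, hρ0.le, by ring, rfl⟩
    rcases le_or_gt t ρ with h1 | h1
    · exact ⟨hxo h1, (seg_sub (left_mem_segment ℝ _ _) hoY).trans hYm⟩
    · exfalso
      apply hgx
      have hT := h.TL hgo ((seg_sub hoY (right_mem_segment ℝ _ _)).trans hYm) hgm
      refine (tri_seg (tri_mem1 _ _ _) (tri_seg (tri_mem2 _ _ _) (tri_mem3 _ _ _) ?_)).trans hT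
      have h2 : 0 < 1 - ρ := by linarith
      refine ⟨(1 - t) / (1 - ρ), (t - ρ) / (1 - ρ), by positivity,
        div_nonneg (by linarith) h2.le, by field_simp; ring, ?_⟩
      rw [hoe, ← hxe]
      ext
      · simp only [Prod.smul_fst, Prod.fst_add, smul_eq_mul]
        field_simp; ring
      · simp only [Prod.smul_snd, Prod.snd_add, smul_eq_mul]
        field_simp; ring

lemma lemmaK {P : Set (ℝ × ℝ)} {g o o' Y R L : ℝ × ℝ} {lam μ σ : ℝ} (hl0 : 0 < lam) (hl1 : lam ≤ 1)
    (hμ : 0 < μ) (hσ : 0 ≤ σ) (hL : L = (1 + μ) • Y - μ • R) (ho : o = lam • o' + (1 - lam) • Y)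
    (hg : g = (1 + σ) • o - σ • L) (hT : tri o' Y R ⊆ P) (hgY : ¬ segment ℝ g Y ⊆ P) :
    ∃ k, k ∈ segment ℝ g o ∧ k ∈ segment ℝ o' R := by
  have hge : g = ((1 + σ) * lam) • o' + ((1 + σ) * (1 - lam) - σ * (1 + μ)) • Y + (σ * μ) • R := by
    rw [hg, hL, ho]; module
  rcases le_or_gt 0 ((1 + σ) * (1 - lam) - σ * (1 + μ)) with h0 | h0
  · exfalso; apply hgY
    refine (tri_seg ?_ (tri_mem2 _ _ _)).trans hT
    exact ⟨_, _, _, by positivity, h0, by positivity, by ring, hge⟩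
  · have hlm : 0 < lam + μ := by positivity
    set s := (1 - lam) / (lam + μ) with hs
    have hs0 : 0 ≤ s := div_nonneg (by linarith) hlm.le
    have hsσ : s < σ := by
      rw [hs, div_lt_iff₀ hlm]; linarith
    have hσ0 : 0 < σ := by linarith
    refine ⟨(s / σ) • g + (1 - s / σ) • o, ⟨s / σ, 1 - s / σ, by positivity, ?_, by ring, rfl⟩, ?_⟩
    · rw [sub_nonneg, div_le_one hσ0]; exact hsσ.le
    · refine ⟨(1 + s) * lam, s * μ, by positivity, by positivity, ?_, ?_⟩
      · rw [hs]; field_simp; ring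
      · rw [hg, hL, ho]
        have e : (lam + μ) * s = 1 - lam := by rw [hs]; field_simp
        have hw : s / σ * σ = s := by field_simp
        generalize s / σ = w at hw
        clear_value s
        ext
        · simp only [Prod.smul_fst, Prod.fst_add, Prod.fst_sub, smul_eq_mul]
          linear_combination (Y.1) * e - ((lam * o'.1 + (1 - lam) * Y.1) -
            ((1 + μ) * Y.1 - μ * R.1)) * hw
        · simp only [Prod.smul_snd, Prod.snd_add, Prod.snd_sub, smul_eq_mul]
          linear_combination (Y.2) * e - ((lam * o'.2 + (1 - lam) * Y.2) -
            ((1 + μ) * Y.2 - μ * R.2)) * hw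

/-- the final algebraic lemma -/
lemma lemmaFA {k' R L k R' L' h' x : ℝ × ℝ} {θ φ ν κ a0 b c0 : ℝ} (hθ0 : 0 < θ) (hθ1 : θ < 1)
    (hφ0 : 0 < φ) (hφ1 : φ ≤ 1) (hν : 0 ≤ ν) (hκ0 : 0 ≤ κ) (hκ1 : κ < 1)
    (ha : 0 ≤ a0) (hc : 0 ≤ c0) (hs : a0 + b + c0 = 1)
    (hk : k = (1 - κ) • k' + κ • L) (hR' : R' = (1 - θ) • R + θ • L)
    (hL' : L' = (1 - φ) • R + φ • R') (hh' : h' = (1 + ν) • k' - ν • R')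
    (hx : x = a0 • k + b • R + c0 • L)
    (hstar : (1 - φ) * ((c0 + a0 * κ) + ν * θ * (a0 * (1 - κ) / (1 + ν))) ≤
      φ * (b * θ - (c0 + a0 * κ) * (1 - θ))) :
    ∃ k'', k'' ∈ segment ℝ h' L' ∧ k'' ∈ segment ℝ k R ∧ x ∈ tri k'' R L' := by
  have h1κ : 0 < 1 - κ := by linarith
  have h1ν : 0 < 1 + ν := by linarith
  set N := (1 + ν) * κ + ν * θ * (1 - κ) with hN
  set M := φ * θ * (1 - κ) with hM
  have hN0 : 0 ≤ N := by positivity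
  have hM0 : 0 < M := by positivity
  have hNM : 0 < N + M := by positivity
  set A := a0 * (1 - κ) / (1 + ν) with hA
  have hA0 : 0 ≤ A := by positivity
  have hAe : A * (1 + ν) = a0 * (1 - κ) := by rw [hA]; field_simp
  have hp : φ * θ * (1 + ν) ≤ N + M := by
    have h1 : 0 ≤ (1 - φ) * ν * θ * (1 - κ) := by
      have : 0 ≤ 1 - φ := by linarith
      positivity
    have h2 : 0 ≤ (1 + ν) * κ * (1 - φ * θ) := by
      have : 0 ≤ 1 - φ * θ := by nlinarith
      positivity
    rw [hN, hM]; linarith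
  refine ⟨(M / (N + M)) • h' + (N / (N + M)) • L', ⟨M / (N+M), N / (N+M), by positivity, by positivity,
    by field_simp; ring, rfl⟩, ⟨φ * θ * (1 + ν) / (N + M), 1 - φ * θ * (1 + ν) / (N + M), by positivity,
    ?_, by ring, ?_⟩, ?_⟩
  · rw [sub_nonneg, div_le_one hNM]; exact hp
  · rw [hk, hh', hL', hR']
    ext
    · simp only [Prod.smul_fst, Prod.fst_add, Prod.fst_sub, smul_eq_mul]
      field_simp
      rw [hN, hM]; ring
    · simp only [Prod.smul_snd, Prod.snd_add, Prod.snd_sub, smul_eq_mul]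
      field_simp
      rw [hN, hM]; ring
  · refine ⟨A * (N + M) / M, 1 - A * (N + M) / M - c0 / (φ * θ), c0 / (φ * θ), by positivity, ?_,
      by positivity, by ring, ?_⟩
    · have e : φ * θ * (1 - A * (N + M) / M - c0 / (φ * θ)) =
          φ * θ - φ * θ * A - ν * θ * A - (c0 + a0 * κ) := by
        have e1 : φ * θ * (A * (N + M) / M) = A * (N + M) / (1 - κ) := by
          rw [hM]; field_simp
        have e2 : A * (N + M) / (1 - κ) = a0 * κ + ν * θ * A + φ * θ * A := by
          rw [div_eq_iff h1κ.ne', hN, hM]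
          linear_combination κ * hAe
        have e3 : φ * θ * (c0 / (φ * θ)) = c0 := by field_simp
        rw [mul_sub, mul_sub, e1, e2, e3]; ring
      have h2 : 0 ≤ φ * θ * (1 - A * (N + M) / M - c0 / (φ * θ)) := by
        rw [e]
        have : b = 1 - c0 - a0 := by linarith
        subst this
        have e4 : a0 = A * (1 + ν) + a0 * κ := by linarith
        nlinarith [mul_pos hφ0 hθ0]
      by_contra hcon; push Not at hcon
      nlinarith [mul_pos hφ0 hθ0]
    · have hb : b = 1 - c0 - a0 := by linarith
      rw [hx, hk, hh', hL', hR', hb]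
      ext
      · simp only [Prod.smul_fst, Prod.fst_add, Prod.fst_sub, smul_eq_mul]
        field_simp
        rw [hN, hM, hA]; field_simp; ring
      · simp only [Prod.smul_snd, Prod.snd_add, Prod.snd_sub, smul_eq_mul]
        field_simp
        rw [hN, hM, hA]; field_simp; ring


lemma tri_axis {p : ℝ × ℝ} {l y r : ℝ} (h1 : l ≤ y) (h2 : y ≤ r) :
    ((y, 0) : ℝ × ℝ) ∈ tri p (l, 0) (r, 0) :=
  tri_seg (tri_mem2 _ _ _) (tri_mem3 _ _ _) (base_mem h1 h2)

lemma closed_sees {P : Set (ℝ × ℝ)} (hP : IsClosed P) {X : Type*} [TopologicalSpace X]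
    {f g : X → ℝ × ℝ} (hf : Continuous f) (hg : Continuous g) :
    IsClosed {z | segment ℝ (f z) (g z) ⊆ P} := by
  have e : {z | segment ℝ (f z) (g z) ⊆ P} =
      ⋂ u ∈ Icc (0:ℝ) 1, {z | (1 - u) • f z + u • g z ∈ P} := by
    ext t
    simp only [mem_ofPred_eq, mem_iInter, segment_eq_image, image_subset_iff]
    rfl
  rw [e]
  apply isClosed_biInter
  intro u _
  exact hP.preimage (by fun_prop)

namespace WVR
variable {n : ℕ} [NeZero n] {P : Set (ℝ × ℝ)} {v : Fin n → ℝ × ℝ} {α β : ℝ}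

lemma interval (h : WVR P v α β) {p : ℝ × ℝ} (hp : p ∈ P) : ∃ l r : ℝ, α ≤ l ∧ l ≤ r ∧ r ≤ β ∧
    ∀ y, α ≤ y → y ≤ β → (segment ℝ p (y, 0) ⊆ P ↔ l ≤ y ∧ y ≤ r) := by
  have hc : IsCompact (Icc α β ∩ {y : ℝ | segment ℝ p ((y, 0) : ℝ × ℝ) ⊆ P}) :=
    isCompact_Icc.inter_right (closed_sees h.closed continuous_const (by fun_prop))
  have hne : (Icc α β ∩ {y : ℝ | segment ℝ p ((y, 0) : ℝ × ℝ) ⊆ P}).Nonempty := by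
    obtain ⟨y, h1, h2, h3⟩ := h.wv p hp
    exact ⟨y, ⟨h1, h2⟩, h3⟩
  obtain ⟨l, ⟨hl1, hl2⟩, hl3⟩ := hc.exists_isLeast hne
  obtain ⟨r, ⟨hr1, hr2⟩, hr3⟩ := hc.exists_isGreatest hne
  refine ⟨l, r, hl1.1, hl3 ⟨hr1, hr2⟩, hr1.2, fun y hy1 hy2 => ⟨fun hs => ⟨hl3 ⟨⟨hy1, hy2⟩, hs⟩,
    hr3 ⟨⟨hy1, hy2⟩, hs⟩⟩, fun hs => ?_⟩⟩
  have hT := h.TL hl2 (h.base_sub hl1.1 hl1.2 hr1.1 hr1.2) hr2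
  exact (tri_seg (tri_mem1 _ _ _) (tri_axis hs.1 hs.2)).trans hT

lemma int_height (h : WVR P v α β) {x : ℝ × ℝ} (hx : x ∈ interior P) : 0 < x.2 := by
  obtain ⟨r, hr, hb⟩ := Metric.isOpen_iff.1 isOpen_interior x hx
  have : ((x.1, x.2 - r / 2) : ℝ × ℝ) ∈ P := by
    apply interior_subset
    apply hb
    rw [mem_ball, Prod.dist_eq]
    simp only [dist_self, Real.dist_eq]
    rw [show x.2 - r / 2 - x.2 = -(r/2) by ring, abs_neg, abs_of_pos (by positivity)]
    exact max_lt hr (by linarith)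
  have := h.half _ this
  simp only at this
  linarith

lemma extend (h : WVR P v α β) {x Y : ℝ × ℝ} (hx : segment ℝ Y x ⊆ P) (hx2 : 0 < x.2)
    (hY : Y.2 = 0) : ∃ z ∈ frontier P, x ∈ segment ℝ Y z ∧ segment ℝ Y z ⊆ P := by
  set f : ℝ → ℝ × ℝ := fun t => (1 - t) • Y + t • x with hf
  have hfc : Continuous f := by fun_prop
  obtain ⟨M, hM⟩ := h.cpt.isBounded.exists_norm_le
  have hb : ∀ t, f t ∈ P → t ≤ M / x.2 := by
    intro t ht
    have h1 := hM _ ht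
    have h2 : (f t).2 = t * x.2 := by simp [hf, hY]
    have h3 : (f t).2 ≤ M := (le_abs_self _).trans ((norm_snd_le (f t)).trans h1)
    rw [le_div_iff₀ hx2, ← h2]; exact h3
  have hc : IsCompact (Icc 1 (M / x.2) ∩ {t | segment ℝ Y (f t) ⊆ P}) :=
    isCompact_Icc.inter_right (closed_sees h.closed continuous_const hfc)
  have hf1 : f 1 = x := by simp [hf]
  obtain ⟨t, ⟨ht1, ht2⟩, ht3⟩ := hc.exists_isGreatest ⟨1, ⟨le_rfl, hb 1 (by
    rw [hf1]; exact hx (right_mem_segment ℝ _ _))⟩, by simpa [hf1] using hx⟩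
  have ht2 : segment ℝ Y (f t) ⊆ P := ht2
  have ht0 : 0 < t := by linarith [ht1.1]
  refine ⟨f t, ?_, ?_, ht2⟩
  · by_contra hcon
    have hft : f t ∈ P := ht2 (right_mem_segment ℝ _ _)
    have hxInt : f t ∈ interior P := by
      by_contra hc'
      exact hcon ⟨subset_closure hft, hc'⟩
    obtain ⟨r, hr, hball⟩ := Metric.isOpen_iff.1 isOpen_interior _ hxInt
    have h3 : ∀ᶠ u in 𝓝[>] t, f u ∈ ball (f t) r :=
      nhdsWithin_le_nhds (hfc.tendsto t (ball_mem_nhds _ hr))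
    obtain ⟨u, hu, hu'⟩ := (h3.and self_mem_nhdsWithin).exists
    have hu' : t < u := hu'
    have hsee : segment ℝ Y (f u) ⊆ P := by
      apply seg_join (x := f t) _ ht2
      · exact (((convex_ball _ _).segment_subset (mem_ball_self hr) hu).trans hball).trans
          interior_subset
      · have hu0 : 0 < u := by linarith
        refine ⟨1 - t / u, t / u, ?_, by positivity, by ring, ?_⟩
        · rw [sub_nonneg, div_le_one hu0]; exact hu'.le
        · simp only [hf]
          ext
          · simp only [Prod.smul_fst, Prod.fst_add, smul_eq_mul]
            field_simp; ring
          · simp only [Prod.smul_snd, Prod.snd_add, smul_eq_mul]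
            field_simp; ring
    have : u ≤ t := ht3 ⟨⟨by linarith [ht1.1], hb u (hsee (right_mem_segment ℝ _ _))⟩, hsee⟩
    linarith
  · refine ⟨1 - 1 / t, 1 / t, ?_, by positivity, by ring, ?_⟩
    · rw [sub_nonneg, div_le_one ht0]; exact ht1.1
    · simp only [hf]
      ext
      · simp only [Prod.smul_fst, Prod.fst_add, smul_eq_mul]
        field_simp; ring
      · simp only [Prod.smul_snd, Prod.snd_add, smul_eq_mul]
        field_simp; ring

/-- set of base points `y` whose segment through `x` reaches `[g, e]` -/
def KS (P : Set (ℝ × ℝ)) (α β : ℝ) (x g : ℝ × ℝ) (e : ℝ) : Set ℝ :=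
  {y | α ≤ y ∧ y ≤ β ∧ ∃ o ∈ segment ℝ g (e, 0), x ∈ segment ℝ ((y, 0) : ℝ × ℝ) o ∧
    segment ℝ ((y, 0) : ℝ × ℝ) o ⊆ P}

lemma KS_closed (hP : IsClosed P) (x g : ℝ × ℝ) (e : ℝ) : IsClosed (KS P α β x g e) := by
  have : KS P α β x g e = Prod.fst '' ((Icc α β ×ˢ Icc (0:ℝ) 1 ×ˢ Icc (0:ℝ) 1) ∩
      ({z : ℝ × ℝ × ℝ | (1 - z.2.2) • ((z.1, 0) : ℝ × ℝ) +
          z.2.2 • ((1 - z.2.1) • g + z.2.1 • ((e, 0) : ℝ × ℝ)) = x} ∩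
       {z : ℝ × ℝ × ℝ | segment ℝ ((z.1, 0) : ℝ × ℝ)
          ((1 - z.2.1) • g + z.2.1 • ((e, 0) : ℝ × ℝ)) ⊆ P})) := by
    ext y
    constructor
    · rintro ⟨h1, h2, o, ho, hx, hs⟩
      rw [segment_eq_image] at ho
      obtain ⟨s, hs', rfl⟩ := ho
      rw [segment_eq_image] at hx
      obtain ⟨w, hw, rfl⟩ := hx
      exact ⟨(y, s, w), ⟨⟨⟨h1, h2⟩, hs', hw⟩, rfl, hs⟩, rfl⟩
    · rintro ⟨⟨y', s, w⟩, ⟨⟨⟨h1, h2⟩, hs', hw⟩, hx, hs⟩, rfl⟩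
      simp only at h1 h2 hs' hw
      refine ⟨h1, h2, _, ?_, ?_, hs⟩
      · rw [segment_eq_image]; exact ⟨s, hs', rfl⟩
      · rw [segment_eq_image]; exact ⟨w, hw, hx⟩
  rw [this]
  apply IsCompact.isClosed
  apply IsCompact.image _ continuous_fst
  apply IsCompact.inter_right
  · exact isCompact_Icc.prod (isCompact_Icc.prod isCompact_Icc)
  · apply IsClosed.inter
    · exact isClosed_eq (by fun_prop) continuous_const
    · exact closed_sees hP (by fun_prop) (by fun_prop)

lemma KS_spec (h : WVR P v α β) {x g : ℝ × ℝ} {e y : ℝ} (he1 : α ≤ e) (he2 : e ≤ β)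
    (hge : segment ℝ g (e, 0) ⊆ P) (hgx : ¬ segment ℝ g x ⊆ P) (hy : y ∈ KS P α β x g e) :
    y ≠ e ∧ segment ℝ x (e, 0) ⊆ P := by
  obtain ⟨h1, h2, o, ho, hx, hs⟩ := hy
  constructor
  · rintro rfl
    apply hgx
    have : x ∈ segment ℝ g (y, 0) := seg_sub (right_mem_segment ℝ _ _) ho hx
    exact (seg_sub (left_mem_segment ℝ _ _) this).trans hge
  · have hT := h.TL hs ((seg_sub ho (right_mem_segment ℝ _ _)).trans hge) (h.base_sub h1 h2 he1 he2)
    exact (tri_seg (tri_seg (tri_mem1 _ _ _) (tri_mem2 _ _ _) hx) (tri_mem3 _ _ _)).trans hT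

lemma twoguards (h : WVR P v α β) {lf rf : ℝ × ℝ → ℝ}
    (hI : ∀ p ∈ P, α ≤ lf p ∧ lf p ≤ rf p ∧ rf p ≤ β ∧
      ∀ y, α ≤ y → y ≤ β → (segment ℝ p (y, 0) ⊆ P ↔ lf p ≤ y ∧ y ≤ rf p))
    {G : Finset (ℝ × ℝ)} (hG : ∀ g ∈ G, g ∈ P)
    (hgu : ∀ x ∈ frontier P, ∃ g ∈ G, segment ℝ g x ⊆ P)
    {x : ℝ × ℝ} (hx : x ∈ P) (hun : ∀ g ∈ G, ¬ segment ℝ g x ⊆ P) :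
    0 < x.2 ∧ ∃ y, ∃ g ∈ G, ∃ k ∈ G, y < lf g ∧ rf k < y ∧ y ∈ KS P α β x g (lf g) ∧
      y ∈ KS P α β x k (rf k) := by
  have hxf : x ∉ frontier P := by
    intro hf
    obtain ⟨g, hg, hs⟩ := hgu x hf
    exact hun g hg hs
  have hxi : x ∈ interior P := by
    by_contra hc
    exact hxf ⟨subset_closure hx, hc⟩
  have hx2 := h.int_height hxi
  refine ⟨hx2, ?_⟩
  have seeL : ∀ g ∈ G, segment ℝ g (lf g, 0) ⊆ P := fun g hg => by
    obtain ⟨a, b, c, d⟩ := hI g (hG g hg)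
    exact (d _ a (b.trans c)).2 ⟨le_rfl, b⟩
  have seeR : ∀ g ∈ G, segment ℝ g (rf g, 0) ⊆ P := fun g hg => by
    obtain ⟨a, b, c, d⟩ := hI g (hG g hg)
    exact (d _ (a.trans b) c).2 ⟨b, le_rfl⟩
  set A : Set ℝ := ⋃ g ∈ G, (Iic (lf g) ∩ KS P α β x g (lf g)) with hA
  set B : Set ℝ := ⋃ g ∈ G, (Ici (rf g) ∩ KS P α β x g (rf g)) with hB
  have hAc : IsClosed A := by
    apply isClosed_biUnion_finset
    intro g _
    exact isClosed_Iic.inter (KS_closed h.closed _ _ _)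
  have hBc : IsClosed B := by
    apply isClosed_biUnion_finset
    intro g _
    exact isClosed_Ici.inter (KS_closed h.closed _ _ _)
  obtain ⟨i1, i2, i3, i4⟩ := hI x hx
  have hA' : ∀ y ∈ A, ∃ g ∈ G, y < lf g ∧ lf g ≤ rf x ∧ y ∈ KS P α β x g (lf g) := by
    intro y hy
    simp only [hA, mem_iUnion] at hy
    obtain ⟨g, hg, hy1, hy2⟩ := hy
    obtain ⟨a, b, c, d⟩ := hI g (hG g hg)
    obtain ⟨s1, s2⟩ := h.KS_spec a (b.trans c) (seeL g hg) (hun g hg) hy2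
    exact ⟨g, hg, lt_of_le_of_ne hy1 s1, ((i4 _ a (b.trans c)).1 s2).2, hy2⟩
  have hB' : ∀ y ∈ B, ∃ g ∈ G, rf g < y ∧ lf x ≤ rf g ∧ y ∈ KS P α β x g (rf g) := by
    intro y hy
    simp only [hB, mem_iUnion] at hy
    obtain ⟨g, hg, hy1, hy2⟩ := hy
    obtain ⟨a, b, c, d⟩ := hI g (hG g hg)
    obtain ⟨s1, s2⟩ := h.KS_spec (a.trans b) c (seeR g hg) (hun g hg) hy2
    exact ⟨g, hg, lt_of_le_of_ne hy1 s1.symm, ((i4 _ (a.trans b) c).1 s2).1, hy2⟩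
  have hcov : Icc (lf x) (rf x) ⊆ A ∪ B := by
    intro y hy
    have hy1 : α ≤ y := i1.trans hy.1
    have hy2 : y ≤ β := hy.2.trans i3
    have hxy := (i4 y hy1 hy2).2 hy
    obtain ⟨z, hz, hxz, hYz⟩ := h.extend (symm_sub hxy) hx2 rfl
    obtain ⟨g, hg, hgz⟩ := hgu z hz
    have hgY : ¬ segment ℝ g (y, 0) ⊆ P := by
      intro hs
      have hT := h.TL hs hYz hgz
      exact hun g hg ((tri_seg (tri_mem1 _ _ _) (tri_seg (tri_mem2 _ _ _) (tri_mem3 _ _ _) hxz)).trans hT)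
    obtain ⟨a, b, c, d⟩ := hI g (hG g hg)
    have hg2 := h.half g (hG g hg)
    rw [d y hy1 hy2] at hgY
    rcases lt_or_ge y (lf g) with h1 | h1
    · left
      obtain ⟨o, ho⟩ := h.lemmaL (h.base_sub hy1 hy2 a (b.trans c)) (seeL g hg)
        (by rw [d y hy1 hy2]; exact hgY) hxz hx2 hg2 hYz hgz (hun g hg)
      simp only [hA, mem_iUnion]
      exact ⟨g, hg, h1.le, hy1, hy2, o, ho⟩
    · right
      have h2 : rf g < y := by
        by_contra hc; exact hgY ⟨h1, not_lt.1 hc⟩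
      obtain ⟨o, ho⟩ := h.lemmaL (h.base_sub hy1 hy2 (a.trans b) c) (seeR g hg)
        (by rw [d y hy1 hy2]; exact hgY) hxz hx2 hg2 hYz hgz (hun g hg)
      simp only [hB, mem_iUnion]
      exact ⟨g, hg, h2.le, hy1, hy2, o, ho⟩
  have hlA : lf x ∈ A := by
    rcases hcov (left_mem_Icc.2 i2) with h1 | h1
    · exact h1
    · obtain ⟨g, _, h2, h3, _⟩ := hB' _ h1
      linarith
  have hrB : rf x ∈ B := by
    rcases hcov (right_mem_Icc.2 i2) with h1 | h1
    · obtain ⟨g, _, h2, h3, _⟩ := hA' _ h1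
      linarith
    · exact h1
  obtain ⟨y, _, hyA, hyB⟩ := isPreconnected_closed_iff.1 isPreconnected_Icc A B hAc hBc hcov
    ⟨_, left_mem_Icc.2 i2, hlA⟩ ⟨_, right_mem_Icc.2 i2, hrB⟩
  obtain ⟨g, hg, g1, _, g2⟩ := hA' y hyA
  obtain ⟨k, hk, k1, _, k2⟩ := hB' y hyB
  exact ⟨y, g, hg, k, hk, g1, k1, g2, k2⟩

/-- crossing of the two sight lines; orientation-free -/
lemma crossing (h : WVR P v α β) {g k o o' x : ℝ × ℝ} {y l r : ℝ} (hy1 : α ≤ y) (hy2 : y ≤ β)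
    (hr1 : α ≤ r) (hr2 : r ≤ β) (hylr : (r - y) * (l - y) < 0)
    (hkr : segment ℝ k (r, 0) ⊆ P) (hgy : ¬ segment ℝ g (y, 0) ⊆ P)
    (ho : o ∈ segment ℝ g (l, 0)) (ho' : o' ∈ segment ℝ k (r, 0))
    (hx2 : 0 < x.2) (hxo : x ∈ segment ℝ ((y, 0) : ℝ × ℝ) o)
    (hxo' : x ∈ segment ℝ ((y, 0) : ℝ × ℝ) o') (hso' : segment ℝ ((y, 0) : ℝ × ℝ) o' ⊆ P)
    (hle : o.2 ≤ o'.2) :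
    ∃ q, q ∈ segment ℝ g (l, 0) ∧ q ∈ segment ℝ k (r, 0) ∧ x ∈ tri q (r, 0) (l, 0) := by
  obtain ⟨w, t, hw, ht, hwt, hxe⟩ := hxo
  obtain ⟨w', t', hw', ht', hwt', hxe'⟩ := hxo'
  obtain rfl : w = 1 - t := by linarith
  obtain rfl : w' = 1 - t' := by linarith
  have e2 : x.2 = t * o.2 := by rw [← hxe]; simp
  have e2' : x.2 = t' * o'.2 := by rw [← hxe']; simp
  have e1 : x.1 = (1 - t) * y + t * o.1 := by rw [← hxe]; simp
  have e1' : x.1 = (1 - t') * y + t' * o'.1 := by rw [← hxe']; simp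
  have ht0 : 0 < t := by
    rcases ht.eq_or_lt with h0 | h0
    · rw [← h0] at e2; linarith
    · exact h0
  have ht0' : 0 < t' := by
    rcases ht'.eq_or_lt with h0 | h0
    · rw [← h0] at e2'; linarith
    · exact h0
  have ho2 : 0 < o.2 := by by_contra hc; push Not at hc; nlinarith
  have ho2' : 0 < o'.2 := by linarith
  obtain ⟨a, τ, ha, hτ, haτ, hoe⟩ := ho
  obtain rfl : a = 1 - τ := by linarith
  have hτ1 : 0 < 1 - τ := by
    rcases ha.eq_or_lt with h0 | h0
    · have : o.2 = 0 := by rw [← hoe, ← h0]; simp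
      linarith
    · exact h0
  have hry : r - y ≠ 0 := by intro h0; rw [h0] at hylr; simp at hylr
  have hμ : 0 < -((l - y) / (r - y)) := by
    rw [show -((l - y) / (r - y)) = -((r - y) * (l - y)) / (r - y)^2 by field_simp]
    apply div_pos (by linarith); positivity
  have hT := h.TL (symm_sub hso') (h.base_sub hy1 hy2 hr1 hr2)
    ((seg_sub ho' (right_mem_segment ℝ _ _)).trans hkr)
  obtain ⟨q, hq1, hq2⟩ := lemmaK (P := P) (g := g) (o := o) (o' := o') (Y := (y,0)) (R := (r,0))
    (L := (l,0)) (lam := o.2 / o'.2) (μ := -((l - y) / (r - y))) (σ := τ / (1 - τ)) (by positivity)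
    (by rw [div_le_one ho2']; exact hle) hμ (by positivity)
    (by
      ext
      · simp only [Prod.smul_fst, Prod.fst_sub, smul_eq_mul]
        field_simp; ring
      · simp)
    (by
      ext
      · simp only [Prod.smul_fst, Prod.fst_add, smul_eq_mul]
        have k1 : t * (o.1 - y) = t' * (o'.1 - y) := by linarith
        have k2 : t * o.2 = t' * o'.2 := by linarith
        have k3 : (o.1 - y) * o'.2 = o.2 * (o'.1 - y) := by
          have : t * t' * ((o.1 - y) * o'.2) = t * t' * (o.2 * (o'.1 - y)) := by
            linear_combination (t' * o'.2) * k1 - t' * (o'.1 - y) * k2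
          exact mul_left_cancel₀ (by positivity) this
        field_simp
        linear_combination k3
      · simp only [Prod.smul_snd, Prod.snd_add, smul_eq_mul]
        field_simp; ring)
    (by
      rw [← hoe]
      ext
      · simp only [Prod.smul_fst, Prod.fst_add, Prod.fst_sub, smul_eq_mul]
        field_simp; ring
      · simp only [Prod.smul_snd, Prod.snd_add, Prod.snd_sub, smul_eq_mul]
        field_simp; ring) hT hgy
  have hoS : o ∈ segment ℝ g (l, 0) := ⟨1 - τ, τ, ha, hτ, haτ, hoe⟩
  refine ⟨q, seg_sub (left_mem_segment ℝ _ _) hoS hq1, seg_sub ho' (right_mem_segment ℝ _ _) hq2, ?_⟩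
  have hoq : o ∈ segment ℝ q (l, 0) := by
    rw [mem_segment_iff_wbtw] at hq1 hoS ⊢
    exact hoS.trans_left_right hq1
  have hoT : o ∈ tri q (r, 0) (l, 0) := tri_seg (tri_mem1 _ _ _) (tri_mem3 _ _ _) hoq
  have hYT : ((y, 0) : ℝ × ℝ) ∈ tri q (r, 0) (l, 0) := by
    apply tri_seg (tri_mem2 q (r,0) (l,0)) (tri_mem3 _ _ _)
    rcases le_total r y with h1 | h1
    · have h2 : y ≤ l := by
        by_contra hc; push Not at hc
        nlinarith
      exact base_mem h1 h2
    · have h2 : l ≤ y := by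
        by_contra hc; push Not at hc
        nlinarith
      rw [segment_symm]
      exact base_mem h2 h1
  exact tri_seg hYT hoT ⟨1 - t, t, hw, ht, hwt, hxe⟩

/-- `g` is a valid left guard for `x` -/
def Val (G : Finset (ℝ × ℝ)) (lf rf : ℝ × ℝ → ℝ) (g x : ℝ × ℝ) : Prop :=
  ∃ k ∈ G, rf k < lf g ∧ ∃ q, q ∈ segment ℝ g (lf g, 0) ∧ q ∈ segment ℝ k (rf k, 0) ∧
    x ∈ tri q (rf k, 0) (lf g, 0)

lemma tri_swap {A B C : ℝ × ℝ} : tri A B C ⊆ tri A C B :=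
  tri_sub_convex (tri_convex _ _ _) (tri_mem1 _ _ _) (tri_mem3 _ _ _) (tri_mem2 _ _ _)

lemma exists_val (h : WVR P v α β) {lf rf : ℝ × ℝ → ℝ}
    (hI : ∀ p ∈ P, α ≤ lf p ∧ lf p ≤ rf p ∧ rf p ≤ β ∧
      ∀ y, α ≤ y → y ≤ β → (segment ℝ p (y, 0) ⊆ P ↔ lf p ≤ y ∧ y ≤ rf p))
    {G : Finset (ℝ × ℝ)} (hG : ∀ g ∈ G, g ∈ P)
    (hgu : ∀ x ∈ frontier P, ∃ g ∈ G, segment ℝ g x ⊆ P)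
    {x : ℝ × ℝ} (hx : x ∈ P) (hun : ∀ g ∈ G, ¬ segment ℝ g x ⊆ P) :
    0 < x.2 ∧ ∃ g ∈ G, Val G lf rf g x := by
  obtain ⟨hx2, y, g, hg, k, hk, h1, h2, ⟨hy1, hy2, o, ho, hxo, hso⟩, ⟨-, -, o', ho', hxo', hso'⟩⟩ :=
    h.twoguards hI hG hgu hx hun
  refine ⟨hx2, g, hg, k, hk, by linarith, ?_⟩
  obtain ⟨a, b, c, d⟩ := hI g (hG g hg)
  obtain ⟨a', b', c', d'⟩ := hI k (hG k hk)
  have hneg : (rf k - y) * (lf g - y) < 0 := mul_neg_of_neg_of_pos (by linarith) (by linarith)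
  rcases le_total o.2 o'.2 with hle | hle
  · exact h.crossing hy1 hy2 (a'.trans b') c' hneg ((d' _ (a'.trans b') c').2 ⟨b', le_rfl⟩)
      (by rw [d y hy1 hy2]; intro hh; linarith [hh.1]) ho ho' hx2 hxo hxo' hso' hle
  · obtain ⟨q, q1, q2, q3⟩ := h.crossing hy1 hy2 a (b.trans c) (by linarith [hneg, mul_comm (rf k - y) (lf g - y)])
      ((d _ a (b.trans c)).2 ⟨le_rfl, b⟩)
      (by rw [d' y hy1 hy2]; intro hh; linarith [hh.2]) ho' ho hx2 hxo' hxo hso hle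
    exact ⟨q, q2, q1, tri_swap q3⟩

end WVR


namespace WVR

lemma core {k' k h' x : ℝ × ℝ} {l r r' l' κ η : ℝ} (hrl : r < l) (hr'l : r' < l) (hl'r' : l' ≤ r')
    (hκ0 : 0 ≤ κ) (hκ1 : κ < 1) (hk : k = (1 - κ) • k' + κ • ((l, 0) : ℝ × ℝ))
    (hη0 : 0 ≤ η) (hη1 : η < 1) (hk' : k' = (1 - η) • h' + η • ((r', 0) : ℝ × ℝ))
    (hx : x ∈ tri k (r, 0) (l, 0)) :
    x ∈ tri k' (r', 0) (l, 0) ∨ x ∈ tri h' (l', 0) (r', 0) ∨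
      (r < l' ∧ ∃ q, q ∈ segment ℝ h' (l', 0) ∧ q ∈ segment ℝ k (r, 0) ∧
        x ∈ tri q (r, 0) (l', 0)) := by
  have hkT : k ∈ tri k' (r', 0) (l, 0) := by
    rw [hk]
    exact tri_seg (tri_mem1 _ _ _) (tri_mem3 _ _ _) ⟨1 - κ, κ, by linarith, hκ0, by ring, rfl⟩
  rcases le_or_gt r' r with h1 | h1
  · left
    refine tri_sub_convex (tri_convex _ _ _) hkT ?_ (tri_mem3 _ _ _) hx
    exact tri_axis h1 hrl.le
  obtain ⟨a0, b, c0, ha, hb, hc, hs, hxe⟩ := hx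
  have hlr : 0 < l - r := by linarith
  obtain ⟨θ, hθ⟩ : ∃ θ, θ = (r' - r) / (l - r) := ⟨_, rfl⟩
  have hθ0 : 0 < θ := by rw [hθ]; apply div_pos <;> linarith
  have hθ1 : θ < 1 := by rw [hθ, div_lt_one hlr]; linarith
  have hr' : r' = (1 - θ) * r + θ * l := by rw [hθ]; field_simp; ring
  have hθ1' : 0 < 1 - θ := by linarith
  have ha' : 0 ≤ a0 * (1 - κ) := mul_nonneg ha (by linarith)
  have hc' : 0 ≤ c0 + a0 * κ := by positivity
  rcases le_or_gt (b * θ) ((c0 + a0 * κ) * (1 - θ)) with h2 | h2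
  · left
    refine ⟨a0 * (1 - κ), b / (1 - θ), (c0 + a0 * κ) - b * θ / (1 - θ), ha', by positivity, ?_, ?_, ?_⟩
    · rw [sub_nonneg, div_le_iff₀ hθ1']; exact h2
    · field_simp; linear_combination (1 - θ) * hs
    · rw [hxe, hk]
      ext
      · simp only [Prod.smul_fst, Prod.fst_add, smul_eq_mul]
        rw [hr']; field_simp; ring
      · simp only [Prod.smul_snd, Prod.snd_add, smul_eq_mul]
        ring
  right
  have hη1' : 0 < 1 - η := by linarith
  have hB1 : 0 ≤ b - (c0 + a0 * κ) * (1 - θ) / θ := by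
    rw [sub_nonneg, div_le_iff₀ hθ0]; exact h2.le
  rcases le_or_gt l' r with h3 | h3
  · left
    have hx' : x ∈ tri k' (r, 0) (r', 0) := by
      refine ⟨a0 * (1 - κ), b - (c0 + a0 * κ) * (1 - θ) / θ, (c0 + a0 * κ) / θ, ha', hB1,
        by positivity, ?_, ?_⟩
      · field_simp; linear_combination θ * hs
      · rw [hxe, hk]
        ext
        · simp only [Prod.smul_fst, Prod.fst_add, smul_eq_mul]
          rw [hr']; field_simp; ring
        · simp only [Prod.smul_snd, Prod.snd_add, smul_eq_mul]
          ring
    refine tri_sub_convex (tri_convex _ _ _) ?_ (tri_axis h3 h1.le) (tri_mem3 _ _ _) hx'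
    exact tri_seg (tri_mem1 _ _ _) (tri_mem3 _ _ _) ⟨1 - η, η, by linarith, hη0, by ring, hk'.symm⟩
  obtain ⟨φ, hφ⟩ : ∃ φ, φ = (l' - r) / (r' - r) := ⟨_, rfl⟩
  have hrr : 0 < r' - r := by linarith
  have hφ0 : 0 < φ := by rw [hφ]; apply div_pos <;> linarith
  have hφ1 : φ ≤ 1 := by rw [hφ, div_le_one hrr]; linarith
  have hl' : l' = (1 - φ) * r + φ * r' := by rw [hφ]; field_simp; ring
  obtain ⟨ν, hν⟩ : ∃ ν, ν = η / (1 - η) := ⟨_, rfl⟩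
  have hν0 : 0 ≤ ν := by rw [hν]; positivity
  have hh' : h' = (1 + ν) • k' - ν • ((r', 0) : ℝ × ℝ) := by
    rw [hk', hν]
    ext
    · simp only [Prod.smul_fst, Prod.fst_add, Prod.fst_sub, smul_eq_mul]
      field_simp; ring
    · simp only [Prod.smul_snd, Prod.snd_add, Prod.snd_sub, smul_eq_mul]
      field_simp; ring
  rcases le_or_gt ((1-φ)*((c0+a0*κ)+ν*θ*(a0*(1-κ)/(1+ν)))) (φ*(b*θ-(c0+a0*κ)*(1-θ))) with hst | hst
  · right
    refine ⟨h3, ?_⟩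
    exact lemmaFA (k' := k') (R := (r,0)) (L := (l,0)) (k := k) (R' := (r',0)) (L' := (l',0))
      (h' := h') (x := x) (θ := θ) (φ := φ) (ν := ν) (κ := κ) (a0 := a0) (b := b) (c0 := c0)
      hθ0 hθ1 hφ0 hφ1 hν0 hκ0 hκ1 ha hc hs hk (by ext <;> simp [hr']) (by ext <;> simp [hl'])
      hh' hxe hst
  · left
    have hφ1' : 0 < 1 - φ := by
      rcases hφ1.eq_or_lt with h0 | h0
      · rw [h0] at hst
        exfalso
        nlinarith
      · linarith
    refine ⟨a0 * (1 - κ) / (1 + ν), (b - (c0 + a0 * κ) * (1 - θ) / θ) / (1 - φ),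
      a0 * (1 - κ) / (1 + ν) * ν + (c0 + a0 * κ) / θ -
        (b - (c0 + a0 * κ) * (1 - θ) / θ) * φ / (1 - φ), by positivity, by positivity, ?_, ?_, ?_⟩
    · have : a0 * (1 - κ) / (1 + ν) * ν + (c0 + a0 * κ) / θ -
        (b - (c0 + a0 * κ) * (1 - θ) / θ) * φ / (1 - φ) =
        ((1-φ)*((c0+a0*κ)+ν*θ*(a0*(1-κ)/(1+ν))) - (φ*(b*θ-(c0+a0*κ)*(1-θ)))) / (θ * (1 - φ)) := by
        field_simp; ring
      rw [this]
      apply div_nonneg (by linarith) (by positivity)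
    · field_simp; linear_combination ((1 - φ) * θ * (1 + ν)) * hs
    · rw [hxe, hk, hh']
      ext
      · simp only [Prod.smul_fst, Prod.fst_add, Prod.fst_sub, smul_eq_mul]
        rw [hl', hr']; field_simp; ring
      · simp only [Prod.smul_snd, Prod.snd_add, Prod.snd_sub, smul_eq_mul]
        field_simp; ring

variable {n : ℕ} [NeZero n] {P : Set (ℝ × ℝ)} {v : Fin n → ℝ × ℝ} {α β : ℝ}

lemma claim (h : WVR P v α β) {lf rf : ℝ × ℝ → ℝ}
    (hI : ∀ p ∈ P, α ≤ lf p ∧ lf p ≤ rf p ∧ rf p ≤ β ∧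
      ∀ y, α ≤ y → y ≤ β → (segment ℝ p (y, 0) ⊆ P ↔ lf p ≤ y ∧ y ≤ rf p))
    {G : Finset (ℝ × ℝ)} (hG : ∀ g ∈ G, g ∈ P) {g : ℝ × ℝ} (hg : g ∈ G) :
    ∃ i, ∀ x, (∀ g ∈ G, ¬ segment ℝ g x ⊆ P) → 0 < x.2 → Val G lf rf g x →
      (∀ h ∈ G, Val G lf rf h x → lf g ≤ lf h) → segment ℝ (v i) x ⊆ P := by
  by_cases hex : ∃ x : ℝ × ℝ, 0 < x.2 ∧ Val G lf rf g x
  swap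
  · exact ⟨0, fun x _ hx hv => absurd ⟨x, hx, hv⟩ hex⟩
  obtain ⟨a, b, c, d⟩ := hI g (hG g hg)
  set m : ℝ → ℝ × ℝ := fun t => (1 - t) • g + t • ((lf g, 0) : ℝ × ℝ) with hm
  have hmc : Continuous m := by fun_prop
  set T : Set ℝ := Icc 0 1 ∩ ⋃ h' ∈ {z ∈ G | rf z < lf g}, {t | m t ∈ segment ℝ h' (rf h', 0)} with hT
  have hTc : IsCompact T := by
    apply isCompact_Icc.inter_right
    apply isClosed_biUnion_finset
    intro z _
    exact (IsClosed.preimage hmc (by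
      rw [segment_eq_image]
      exact (isCompact_Icc.image (by fun_prop)).isClosed))
  have hpos : ∀ {x q : ℝ × ℝ} {r l : ℝ}, 0 < x.2 → x ∈ tri q (r, 0) (l, 0) → 0 < q.2 := by
    rintro x q r l hx ⟨a, b, c, ha, hb, hc, hs, rfl⟩
    simp at hx
    by_contra hcon
    push Not at hcon
    nlinarith
  have hval : ∀ x : ℝ × ℝ, 0 < x.2 → Val G lf rf g x → ∃ t ∈ T, t < 1 ∧ ∃ k ∈ G, rf k < lf g ∧
      m t ∈ segment ℝ k (rf k, 0) ∧ x ∈ tri (m t) (rf k, 0) (lf g, 0) := by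
    rintro x hx ⟨k, hk, hkl, q, hq1, hq2, hq3⟩
    rw [segment_eq_image] at hq1
    obtain ⟨t, ht, rfl⟩ := hq1
    refine ⟨t, ⟨ht, ?_⟩, ?_, k, hk, hkl, hq2, hq3⟩
    · simp only [mem_iUnion]
      exact ⟨k, by simp [hk, hkl], hq2⟩
    · have := hpos hx hq3
      simp at this
      by_contra hcon
      have : t = 1 := le_antisymm ht.2 (not_lt.1 hcon)
      simp_all
  obtain ⟨x1, hx1, hv1⟩ := hex
  obtain ⟨t1, ht1, ht11, -⟩ := hval x1 hx1 hv1
  obtain ⟨t', ⟨ht'I, ht'U⟩, ht'min⟩ := hTc.exists_isLeast ⟨t1, ht1⟩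
  have ht'1 : t' < 1 := lt_of_le_of_lt (ht'min ht1) ht11
  simp only [mem_iUnion, Finset.mem_filter] at ht'U
  obtain ⟨h', ⟨hh'G, hh'l⟩, hk'⟩ := ht'U
  have hk' : m t' ∈ segment ℝ h' (rf h', 0) := hk'
  obtain ⟨a', b', c', d'⟩ := hI h' (hG h' hh'G)
  have seeL := (d _ a (b.trans c)).2 ⟨le_rfl, b⟩
  have seeR' := (d' _ (a'.trans b') c').2 ⟨b', le_rfl⟩
  have seeL' := (d' _ a' (b'.trans c')).2 ⟨le_rfl, b'⟩
  obtain ⟨i, hi⟩ := h.vertex_lemma (g := g) (l := lf g) (y := rf h') (t' := t') a (b.trans c)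
    (a'.trans b') c' seeL (by rw [d _ (a'.trans b') c']; intro hh; linarith [hh.1]) ht'I.1 ht'1
    ((seg_sub hk' (right_mem_segment ℝ _ _)).trans seeR')
  refine ⟨i, fun x hun hx hv hmin => hi x ?_⟩
  obtain ⟨t, htT, htlt, k, hkG, hkl, hmk, hxT⟩ := hval x hx hv
  have htt := ht'min htT
  have hmt2 : 0 < (m t).2 := hpos hx hxT
  have h1t : 0 < 1 - t' := by linarith
  obtain ⟨u, η, hu, hη, huη, hke⟩ := hk'
  obtain rfl : u = 1 - η := by linarith
  have hmt : m t = (1 - (t - t') / (1 - t')) • m t' + ((t - t') / (1 - t')) • ((lf g, 0) : ℝ × ℝ) := by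
    simp only [hm]
    ext
    · simp only [Prod.smul_fst, Prod.fst_add, smul_eq_mul]
      field_simp; ring
    · simp only [Prod.smul_snd, Prod.snd_add, smul_eq_mul]
      field_simp; ring
  have hη1 : η < 1 := by
    by_contra hcon
    have : η = 1 := by linarith
    have h0 : (m t').2 = 0 := by rw [← hke, this]; simp
    rw [hmt] at hmt2
    simp only [Prod.smul_snd, Prod.snd_add, smul_eq_mul, h0] at hmt2
    simp at hmt2
  rcases core (k' := m t') (k := m t) (h' := h') (x := x) (l := lf g) (r := rf k) (r' := rf h')
    (l' := lf h') hkl hh'l b' (div_nonneg (by linarith) h1t.le)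
    (by rw [div_lt_one h1t]; linarith) hmt hη hη1 hke.symm hxT with h1 | h1 | ⟨h1, q, hq1, hq2, hq3⟩
  · exact h1
  · exfalso
    have := h.TL seeL' (h.base_sub a' (b'.trans c') (a'.trans b') c') seeR'
    exact hun h' hh'G ((tri_seg (tri_mem1 _ _ _) h1).trans this)
  · exfalso
    have := hmin h' hh'G ⟨k, hkG, h1, q, hq1, seg_sub hmk (right_mem_segment ℝ _ _) hq2, hq3⟩
    linarith

theorem main (h : WVR P v α β) {G : Finset (ℝ × ℝ)} (hG : ∀ g ∈ G, g ∈ P)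
    (hgu : ∀ x ∈ frontier P, ∃ g ∈ G, segment ℝ g x ⊆ P) :
    ∃ c : ℝ × ℝ → Fin n, ∀ p ∈ P, (∃ g ∈ G, segment ℝ g p ⊆ P) ∨
      ∃ g ∈ G, segment ℝ (v (c g)) p ⊆ P := by
  classical
  have hI : ∀ p, ∃ l r : ℝ, p ∈ P → α ≤ l ∧ l ≤ r ∧ r ≤ β ∧
      ∀ y, α ≤ y → y ≤ β → (segment ℝ p (y, 0) ⊆ P ↔ l ≤ y ∧ y ≤ r) := by
    intro p
    by_cases hp : p ∈ P
    · obtain ⟨l, r, hh⟩ := h.interval hp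
      exact ⟨l, r, fun _ => hh⟩
    · exact ⟨0, 0, fun hh => absurd hh hp⟩
  choose lf rf hI using hI
  have hc : ∀ g, ∃ i : Fin n, g ∈ G → ∀ x, (∀ g ∈ G, ¬ segment ℝ g x ⊆ P) → 0 < x.2 → Val G lf rf g x →
      (∀ h ∈ G, Val G lf rf h x → lf g ≤ lf h) → segment ℝ (v i) x ⊆ P := by
    intro g
    by_cases hg : g ∈ G
    · obtain ⟨i, hi⟩ := h.claim hI hG hg
      exact ⟨i, fun _ => hi⟩
    · exact ⟨0, fun hh => absurd hh hg⟩
  choose c hc using hc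
  refine ⟨c, fun p hp => ?_⟩
  by_cases hgd : ∃ g ∈ G, segment ℝ g p ⊆ P
  · exact Or.inl hgd
  right
  push Not at hgd
  obtain ⟨hp2, g0, hg0, hv0⟩ := h.exists_val hI hG hgu hp hgd
  obtain ⟨g, hgm, hgmin⟩ := Finset.exists_min_image ({z ∈ G | Val G lf rf z p}) lf
    ⟨g0, by simp [hg0, hv0]⟩
  simp only [Finset.mem_filter] at hgm hgmin
  exact ⟨g, hgm.1, hc g hgm.1 p hgd hp2 hgm.2 fun z hz hz' => hgmin z ⟨hz, hz'⟩⟩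

end WVR

lemma exists_chart (f : EuclideanSpace ℝ (Fin 2) →ₗ[ℝ] ℝ) (hf : f ≠ 0)
    (o : EuclideanSpace ℝ (Fin 2)) :
    ∃ Φ : EuclideanSpace ℝ (Fin 2) ≃ₜ ℝ × ℝ, (∀ p, (Φ p).2 = f p - f o) ∧
      ∀ a b, Φ '' segment ℝ a b = segment ℝ (Φ a) (Φ b) := by
  have hfe : ∀ p : EuclideanSpace ℝ (Fin 2), f p = p 0 * f !₂[1, 0] + p 1 * f !₂[0, 1] := by
    intro p
    conv_lhs => rw [show p = p 0 • !₂[(1:ℝ), 0] + p 1 • !₂[(0:ℝ), 1] by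
      ext i; fin_cases i <;> simp]
    rw [map_add, map_smul, map_smul, smul_eq_mul, smul_eq_mul]
  set f0 := f !₂[1, 0] with hf0
  set f1 := f !₂[0, 1] with hf1
  have hne : f0 ^ 2 + f1 ^ 2 ≠ 0 := by
    intro h0
    apply hf
    have h1 : f0 = 0 := by nlinarith [sq_nonneg f0, sq_nonneg f1]
    have h2 : f1 = 0 := by nlinarith [sq_nonneg f0, sq_nonneg f1]
    ext p
    rw [hfe p, h1, h2]; simp
  let ψ : EuclideanSpace ℝ (Fin 2) →ₗ[ℝ] ℝ :=
    { toFun := fun p => - p 0 * f1 + p 1 * f0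
      map_add' := by intro p q; simp; ring
      map_smul' := by intro c p; simp; ring }
  have hinj : Function.Injective (ψ.prod f) := by
    rw [injective_iff_map_eq_zero]
    intro p hp
    have e1 : - p 0 * f1 + p 1 * f0 = 0 := congrArg Prod.fst hp
    have e2 : f p = 0 := congrArg Prod.snd hp
    rw [hfe p] at e2
    have h0 : p 0 = 0 := by
      have : p 0 * (f0 ^ 2 + f1 ^ 2) = 0 := by linear_combination f0 * e2 - f1 * e1
      exact (mul_eq_zero.1 this).resolve_right hne
    have h1 : p 1 = 0 := by
      have : p 1 * (f0 ^ 2 + f1 ^ 2) = 0 := by linear_combination f1 * e2 + f0 * e1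
      exact (mul_eq_zero.1 this).resolve_right hne
    ext i; fin_cases i <;> simp [h0, h1]
  let L : EuclideanSpace ℝ (Fin 2) ≃ₗ[ℝ] ℝ × ℝ :=
    LinearEquiv.ofInjectiveOfFinrankEq (ψ.prod f) hinj (by simp)
  have hL : ∀ p, (L p).2 = f p := fun p => rfl
  refine ⟨L.toContinuousLinearEquiv.toHomeomorph.trans (Homeomorph.addRight (-(L o))), ?_, ?_⟩
  · intro p
    show (L p + -(L o)).2 = _
    rw [Prod.snd_add, Prod.snd_neg, hL, hL]; ring
  · intro a b
    have : ∀ p, (L.toContinuousLinearEquiv.toHomeomorph.trans (Homeomorph.addRight (-(L o)))) p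
      = L p + -(L o) := fun p => rfl
    rw [segment_eq_image, segment_eq_image, image_image]
    apply image_congr
    intro t _
    rw [this, this, this, map_add, map_smul, map_smul]
    module

lemma transfer_spr {n : ℕ} [NeZero n]
    {P : Set (EuclideanSpace ℝ (Fin 2))} {v : Fin n → EuclideanSpace ℝ (Fin 2)}
    (hP : IsSimplePolygonRegion P v) (Φ : EuclideanSpace ℝ (Fin 2) ≃ₜ ℝ × ℝ)
    (hseg : ∀ a b, Φ '' segment ℝ a b = segment ℝ (Φ a) (Φ b)) :
    SPR (Φ '' P) (fun i => Φ (v i)) := by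
  obtain ⟨h1, h2, h3, h4, h5, h6, h7, h8⟩ := hP
  refine ⟨h1, Φ.injective.comp h2, h3.image Φ.continuous, ?_, ?_, ?_, ?_, ?_⟩
  · rw [← Φ.image_interior]; exact h4.image _
  · rw [← Φ.image_interior, ← Φ.image_closure, ← h5]
  · rw [← Φ.image_frontier, h6, image_iUnion]
    simp only [hseg]
  · intro i
    rw [← hseg, ← hseg, ← image_inter Φ.injective, h7, image_singleton]
  · intro i j a b c
    rw [← hseg, ← hseg]
    exact (disjoint_image_iff Φ.injective).2 (h8 i j a b c)

lemma final_main {n : ℕ} [NeZero n]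
    (P : Set (EuclideanSpace ℝ (Fin 2))) (v : Fin n → EuclideanSpace ℝ (Fin 2))
    (hP : IsSimplePolygonRegion P v)
    (hhalf : ∃ (f : EuclideanSpace ℝ (Fin 2) →ₗ[ℝ] ℝ) (c : ℝ),
      f ≠ 0 ∧ f (v (-1)) = c ∧ f (v 0) = c ∧ ∀ p ∈ P, c ≤ f p)
    (hwv : ∀ p ∈ P, ∃ q ∈ segment ℝ (v (-1)) (v 0), segment ℝ q p ⊆ P)
    (G : Finset (EuclideanSpace ℝ (Fin 2)))
    (hG_vert : ↑G ⊆ Set.range v)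
    (hG_guards : ∀ x ∈ frontier P, ∃ g ∈ G, segment ℝ g x ⊆ P) :
    ∃ G' : Finset (EuclideanSpace ℝ (Fin 2)),
      ↑G' ⊆ Set.range v ∧ G'.card ≤ G.card ∧
      ∀ p ∈ P, ∃ g ∈ (↑G ∪ ↑G' : Set (EuclideanSpace ℝ (Fin 2))), segment ℝ g p ⊆ P := by
  classical
  obtain ⟨f, c, hf, hf1, hf0, hfP⟩ := hhalf
  obtain ⟨Φ, hΦ2, hseg⟩ := exists_chart f hf (v 0)
  have hS := transfer_spr hP Φ hseg
  have hsub : ∀ a b, segment ℝ (Φ a) (Φ b) ⊆ Φ '' P ↔ segment ℝ a b ⊆ P := by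
    intro a b
    rw [← hseg, image_subset_image_iff Φ.injective]
  have e1 : Φ (v (-1)) = ((Φ (v (-1))).1, 0) := by
    ext
    · rfl
    · rw [hΦ2, hf1, hf0]; simp
  have e0 : Φ (v 0) = ((Φ (v 0)).1, 0) := by
    ext
    · rfl
    · rw [hΦ2]; simp
  have hne : (Φ (v (-1))).1 ≠ (Φ (v 0)).1 := by
    intro he
    have h3 : (-1 : Fin n) = 0 := by
      apply hS.inj
      show Φ (v (-1)) = Φ (v 0)
      rw [e1, e0, he]
    have h4 := hS.add_one_ne 0
    apply h4
    have : (1 : Fin n) = 0 := neg_eq_zero.1 h3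
    rw [this, add_zero]
  have hW : ∃ α β, WVR (Φ '' P) (fun i => Φ (v i)) α β := by
    have hbase : ∃ α β : ℝ, α < β ∧ segment ℝ (Φ (v (-1))) (Φ (v 0)) =
        segment ℝ ((α, 0) : ℝ × ℝ) (β, 0) := by
      rcases lt_or_gt_of_ne hne with h1 | h1
      · exact ⟨_, _, h1, by rw [← e1, ← e0]⟩
      · exact ⟨_, _, h1, by rw [← e1, ← e0, segment_symm]⟩
    obtain ⟨α, β, hab, hb⟩ := hbase
    refine ⟨α, β, hS, hab, hb, ?_, ?_⟩
    · rintro _ ⟨p, hp, rfl⟩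
      rw [hΦ2, hf0]
      linarith [hfP p hp]
    · rintro _ ⟨p, hp, rfl⟩
      obtain ⟨q, hq, hqp⟩ := hwv p hp
      have hq' : Φ q ∈ segment ℝ ((α, 0) : ℝ × ℝ) (β, 0) := by
        rw [← hb, ← hseg]; exact ⟨q, hq, rfl⟩
      rw [segment_eq_image] at hq'
      obtain ⟨t, ht, hqe⟩ := hq'
      have hqe : (1 - t) • ((α, 0) : ℝ × ℝ) + t • ((β, 0) : ℝ × ℝ) = Φ q := hqe
      have hqe' : (((1 - t) * α + t * β, 0) : ℝ × ℝ) = Φ q := by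
        rw [← hqe]; simp
      refine ⟨(1 - t) * α + t * β, ?_, ?_, ?_⟩
      · nlinarith [ht.1, ht.2]
      · nlinarith [ht.1, ht.2]
      · rw [hqe', hsub, segment_symm]; exact hqp
  obtain ⟨α, β, hW⟩ := hW
  have hGP : ∀ g ∈ G, g ∈ P := by
    intro g hg
    obtain ⟨i, rfl⟩ := hG_vert hg
    have : v i ∈ frontier P := by
      rw [hP.2.2.2.2.2.1]
      exact mem_iUnion.2 ⟨i, left_mem_segment ℝ _ _⟩
    exact hP.2.2.1.isClosed.frontier_subset this
  obtain ⟨c', hc'⟩ := hW.main (G := G.image Φ) (by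
      intro g hg
      obtain ⟨g', hg', rfl⟩ := Finset.mem_image.1 hg
      exact ⟨g', hGP g' hg', rfl⟩) (by
      intro x hx
      rw [← Φ.image_frontier] at hx
      obtain ⟨y, hy, rfl⟩ := hx
      obtain ⟨g, hg, hs⟩ := hG_guards y hy
      exact ⟨Φ g, Finset.mem_image_of_mem _ hg, (hsub _ _).2 hs⟩)
  refine ⟨G.image (fun g => v (c' (Φ g))), ?_, Finset.card_image_le, ?_⟩
  · intro x hx
    obtain ⟨g, _, rfl⟩ := Finset.mem_image.1 (Finset.mem_coe.1 hx)
    exact ⟨_, rfl⟩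
  · intro p hp
    rcases hc' (Φ p) ⟨p, hp, rfl⟩ with ⟨g, hg, hs⟩ | ⟨g, hg, hs⟩
    · obtain ⟨g', hg', rfl⟩ := Finset.mem_image.1 hg
      exact ⟨g', Or.inl hg', (hsub _ _).1 hs⟩
    · obtain ⟨g', hg', rfl⟩ := Finset.mem_image.1 hg
      exact ⟨_, Or.inr (Finset.mem_coe.2 (Finset.mem_image_of_mem _ hg')), (hsub _ _).1 hs⟩

end Aux

theorem wv_polygon_vertex_guarding {n : ℕ} [NeZero n]
    (P : Set (EuclideanSpace ℝ (Fin 2))) (v : Fin n → EuclideanSpace ℝ (Fin 2))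
    (hP : IsSimplePolygonRegion P v)
    -- `P` lies in a closed half-plane bounded by the line through `v (-1)` (= vₙ)
    -- and `v 0` (= v₁); note `[v (-1), v 0]` is automatically an edge of `P`.
    (hhalf : ∃ (f : EuclideanSpace ℝ (Fin 2) →ₗ[ℝ] ℝ) (c : ℝ),
      f ≠ 0 ∧ f (v (-1)) = c ∧ f (v 0) = c ∧ ∀ p ∈ P, c ≤ f p)
    -- `P` is weakly visible from the edge `[v (-1), v 0]`
    (hwv : ∀ p ∈ P, ∃ q ∈ segment ℝ (v (-1)) (v 0), segment ℝ q p ⊆ P)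
    (G : Finset (EuclideanSpace ℝ (Fin 2)))
    (hG_vert : ↑G ⊆ Set.range v)
    (hG_guards : ∀ x ∈ frontier P, ∃ g ∈ G, segment ℝ g x ⊆ P) :
    ∃ G' : Finset (EuclideanSpace ℝ (Fin 2)),
      ↑G' ⊆ Set.range v ∧ G'.card ≤ G.card ∧
      ∀ p ∈ P, ∃ g ∈ (↑G ∪ ↑G' : Set (EuclideanSpace ℝ (Fin 2))), segment ℝ g p ⊆ P := by
  exact final_main P v hP hhalf hwv G hG_vert hG_guards
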